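/- Suppose the seminorm N satisfies N(ν) ≤ Σ_{f∈F} d(f)|ν(f)| for every finite signed measure ν, where F is a countable family of measurable functions satisfying Assumption 1 and the d(f) are positive constants with Σ_{f∈F} d(f)‖f‖ < ∞, and suppose there is a positive sequence (b_n) such that P[N(P_n − Q_n) ≤ b_n] → 0 as n → ∞ and b_n^{−1}·[n^{−ρ̄/2}(1 + ln(n)·1{γ−1+ρ̄/2 = 0}) + n^{γ−1}] → 0 as n → ∞. Then the estimator is consistent: for every η > 0, P(|θ̂_n − θ| > η) → 0 as n → ∞. -/

import Mathlib

open MeasureTheory Filter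

/-- The integral `ν(f) = ∫ f dν` of a function against a finite signed measure,
via the Jordan decomposition. -/
noncomputable def sIntegral {E : Type*} [MeasurableSpace E] (ν : SignedMeasure E) (f : E → ℝ) : ℝ :=
  ∫ x, f x ∂ν.toJordanDecomposition.posPart - ∫ x, f x ∂ν.toJordanDecomposition.negPart

/-- Covariance of two real random variables. -/
noncomputable def covar {Ω : Type*} [MeasurableSpace Ω] (μ : Measure Ω) (Y Z : Ω → ℝ) : ℝ :=
  ∫ ω, (Y ω - ∫ ω', Y ω' ∂μ) * (Z ω - ∫ ω', Z ω' ∂μ) ∂μ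

/-- Variance of a real random variable. -/
noncomputable def variance' {Ω : Type*} [MeasurableSpace Ω] (μ : Measure Ω) (Y : Ω → ℝ) : ℝ :=
  covar μ Y Y

/-- `A_n = O_p(c_n)`: `lim_{M→∞} limsup_{n→∞} P(|A_n| > M c_n) = 0`. -/
def IsOp {Ω : Type*} [MeasurableSpace Ω] (μ : Measure Ω) (A : ℕ → Ω → ℝ) (c : ℕ → ℝ) : Prop :=
  Tendsto (fun M : ℝ => Filter.limsup (fun n => μ {ω | M * c n < |A n ω|}) atTop)
    atTop (nhds 0)

/-- If a signed measure gives arbitrarily large mass to level sets `{v ≤ |f|}` weighted by `v`, then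
`f` is not integrable against its positive part. -/
theorem integral_posPart_eq_zero {E : Type*} [MeasurableSpace E] (σ : SignedMeasure E)
    {f : E → ℝ}
    (h : ∀ K : ℝ, ∃ B : Set E, MeasurableSet B ∧ ∃ v : ℝ, 0 ≤ v ∧ (∀ x ∈ B, v ≤ |f x|) ∧
      K < v * σ B) :
    ∫ x, f x ∂σ.toJordanDecomposition.posPart = 0 := by
  apply integral_undef
  intro hint
  set p := σ.toJordanDecomposition.posPart with hp
  obtain ⟨B, hB, v, hv, hvB, hK⟩ := h (∫ x, |f x| ∂p)
  have h1 : σ B ≤ p.real B := by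
    rw [SignedMeasure.apply_eq_posPart_real_sub_negPart_real σ hB]
    linarith [measureReal_nonneg (μ := σ.toJordanDecomposition.negPart) (s := B)]
  have h2 : v * p.real B ≤ ∫ x in B, |f x| ∂p := by
    have := setIntegral_mono_on (μ := p) (s := B) (f := fun _ => v) (g := fun x => |f x|)
      (integrable_const v).integrableOn hint.abs.integrableOn hB hvB
    rw [setIntegral_const, smul_eq_mul, mul_comm] at this
    exact this
  have h3 : ∫ x in B, |f x| ∂p ≤ ∫ x, |f x| ∂p :=
    setIntegral_le_integral hint.abs (Eventually.of_forall fun x => abs_nonneg _)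
  nlinarith [mul_le_mul_of_nonneg_left h1 hv]

theorem sIntegral_eq_zero_of_large {E : Type*} [MeasurableSpace E] (σ : SignedMeasure E)
    {f : E → ℝ}
    (h : ∀ (β : Bool) (K : ℝ), ∃ B : Set E, MeasurableSet B ∧ ∃ v : ℝ, 0 ≤ v ∧
      (∀ x ∈ B, v ≤ |f x|) ∧ K < v * (if β then σ B else -σ B)) :
    sIntegral σ f = 0 := by
  have h1 := integral_posPart_eq_zero σ (f := f) (fun K => by simpa using h true K)
  have h2 := integral_posPart_eq_zero (-σ) (f := f) (fun K => by
    simpa using h false K)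
  rw [SignedMeasure.toJordanDecomposition_neg, JordanDecomposition.neg_posPart] at h2
  rw [sIntegral, h1, h2, sub_zero]

theorem exists_level_measure_le {E : Type*} [MeasurableSpace E] (m : Measure E) [IsFiniteMeasure m]
    {f : E → ℝ} (hf : Measurable f) {δ : ℝ} (hδ : 0 < δ) :
    ∃ T : ℝ, m.real {x | T ≤ |f x|} ≤ δ := by
  have h : Tendsto (fun n : ℕ => m {x | (n : ℝ) ≤ |f x|}) atTop (nhds 0) := by
    have h0 : ⋂ n : ℕ, {x | (n : ℝ) ≤ |f x|} = ∅ := by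
      ext x
      simp only [Set.mem_iInter, Set.mem_ofPred_eq, Set.mem_empty_iff_false, iff_false, not_forall,
        not_le]
      exact exists_nat_gt _
    have := tendsto_measure_iInter_atTop (μ := m) (s := fun n : ℕ => {x | (n : ℝ) ≤ |f x|})
      (fun n => (measurableSet_le measurable_const hf.abs).nullMeasurableSet)
      (fun i j hij x hx => by
        rw [Set.mem_ofPred_eq] at hx ⊢
        exact le_trans (by exact_mod_cast hij) hx) ⟨0, measure_ne_top _ _⟩
    rwa [h0, measure_empty] at this
  obtain ⟨n, hn⟩ := (h.eventually (gt_mem_nhds (ENNReal.ofReal_pos.2 hδ))).exists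
  exact ⟨n, ENNReal.toReal_le_of_le_ofReal hδ.le hn.le⟩

theorem exists_seq_of_forall_finset {α : Type*} (R : ℕ → Finset α → α → Prop)
    (h : ∀ n S, ∃ y, R n S y) :
    ∃ x : ℕ → α, ∀ n, ∃ S : Finset α, (∀ i < n, x i ∈ S) ∧ R n S (x n) := by
  classical
  choose c hc using h
  let S : ℕ → Finset α := fun n => Nat.rec ∅ (fun n T => insert (c n T) T) n
  have hS : ∀ n, S (n + 1) = insert (c n (S n)) (S n) := fun n => rfl
  have hmem : ∀ n, ∀ i < n, c i (S i) ∈ S n := by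
    intro n
    induction n with
    | zero => intro i hi; omega
    | succ n ih =>
      intro i hi
      rw [hS, Finset.mem_insert]
      rcases Nat.lt_succ_iff_lt_or_eq.1 hi with h | rfl
      · exact Or.inr (ih i h)
      · exact Or.inl rfl
  exact ⟨fun n => c n (S n), fun n => ⟨S n, hmem n, hc n (S n)⟩⟩

/-- The part, of sign `β`, of the atomic measure with mass `4⁻ˢ` and sign `sgn s` at `x s`. -/
noncomputable def atomicPart {E : Type*} [MeasurableSpace E] (x : ℕ → E) (sgn : ℕ → Bool)
    (β : Bool) : Measure E :=
  Measure.sum fun s => (if sgn s = β then ENNReal.ofReal ((1 / 4) ^ s) else 0) •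
    Measure.dirac (x s)

theorem atomicPart_apply_le {E : Type*} [MeasurableSpace E] (x : ℕ → E) (sgn : ℕ → Bool)
    (β : Bool) {B : Set E} (hB : MeasurableSet B) (s : ℕ) (h : ∀ i < s, sgn i = β → x i ∉ B) :
    atomicPart x sgn β B ≤ ENNReal.ofReal ((1 / 4) ^ s * (4 / 3)) := by
  rw [atomicPart, Measure.sum_apply _ hB, ← Summable.sum_add_tsum_nat_add' (k := s)
    ENNReal.summable, Finset.sum_eq_zero, zero_add]
  · calc _ ≤ ∑' i : ℕ, ENNReal.ofReal ((1 / 4) ^ s * (1 / 4) ^ i) := by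
          refine ENNReal.tsum_le_tsum fun i => ?_
          rw [← pow_add, add_comm s i]
          simp only [Measure.smul_apply, smul_eq_mul]
          calc _ ≤ ENNReal.ofReal ((1 / 4) ^ (i + s)) * 1 := by
                gcongr
                · split_ifs <;> simp
                · exact prob_le_one
            _ = _ := mul_one _
      _ = _ := by
          rw [← ENNReal.ofReal_tsum_of_nonneg (fun i => by positivity)
            ((summable_geometric_of_lt_one (by norm_num) (by norm_num)).mul_left _), tsum_mul_left,
            tsum_geometric_of_lt_one (by norm_num) (by norm_num)]
          norm_num
  · intro i hi
    by_cases hs : sgn i = β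
    · rw [if_pos hs, Measure.smul_apply, Measure.dirac_apply' _ hB,
        Set.indicator_of_notMem (h i (Finset.mem_range.1 hi) hs), smul_zero]
    · simp [hs]

theorem isFiniteMeasure_atomicPart {E : Type*} [MeasurableSpace E] (x : ℕ → E) (sgn : ℕ → Bool)
    (β : Bool) : IsFiniteMeasure (atomicPart x sgn β) :=
  ⟨(atomicPart_apply_le x sgn β MeasurableSet.univ 0 (by simp)).trans_lt ENNReal.ofReal_lt_top⟩

theorem le_atomicPart_apply {E : Type*} [MeasurableSpace E] (x : ℕ → E) (sgn : ℕ → Bool)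
    {B : Set E} (hB : MeasurableSet B) (s : ℕ) (h : x s ∈ B) :
    ENNReal.ofReal ((1 / 4) ^ s) ≤ atomicPart x sgn (sgn s) B := by
  rw [atomicPart, Measure.sum_apply _ hB]
  refine le_trans ?_ (ENNReal.le_tsum s)
  simp [Measure.dirac_apply' _ hB, h]

/-- For a countable family of unbounded functions and a signed measure `μ` there is a signed measure
`ν` such that no function of the family is integrable against either part of `a μ + t ν`. -/
theorem exists_signedMeasure_sIntegral_eq_zero {E : Type*} [MeasurableSpace E]
    (G : Set (E → ℝ)) (hG : G.Countable) (hmeas : ∀ f ∈ G, Measurable f)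
    (hunb : ∀ f ∈ G, ∀ B : ℝ, ∃ x, B < |f x|) (μ : SignedMeasure E) :
    ∃ ν : SignedMeasure E, ∀ a t : ℝ, |a| ≤ 1 → 0 < t → ∀ f ∈ G,
      sIntegral (a • μ + t • ν) f = 0 := by
  rcases G.eq_empty_or_nonempty with rfl | hne
  · exact ⟨0, by simp⟩
  have := hG.to_subtype
  have := hne.to_subtype
  obtain ⟨e, he⟩ := exists_surjective_nat (G × Bool × ℕ)
  have : IsFiniteMeasure μ.totalVariation := by
    unfold SignedMeasure.totalVariation; infer_instance
  let g : ℕ → E → ℝ := fun s => (e s).1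
  let k : ℕ → ℕ := fun s => (e s).2.2
  let sgn : ℕ → Bool := fun s => (e s).2.1
  have hg : ∀ s, Measurable (g s) := fun s => hmeas _ (e s).1.2
  have hT : ∀ s, ∃ T : ℝ, μ.totalVariation.real {x | T ≤ |g s x|} ≤ (1 / 4) ^ s / (k s + 1) :=
    fun s => exists_level_measure_le _ (hg s) (by positivity)
  choose T hT using hT
  obtain ⟨x, hx⟩ := exists_seq_of_forall_finset
    (fun s S y => T s ≤ |g s y| ∧ 4 ^ s * (k s : ℝ) ≤ |g s y| ∧ ∀ z ∈ S, |g s z| < |g s y|) (by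
      intro s S
      obtain ⟨y, hy⟩ := hunb _ (e s).1.2
        (max (T s) (4 ^ s * (k s : ℝ)) + ∑ z ∈ S, |g s z|)
      have hS : 0 ≤ ∑ z ∈ S, |g s z| := Finset.sum_nonneg fun z _ => abs_nonneg _
      have h1 := le_max_left (T s) (4 ^ s * (k s : ℝ))
      have h2 := le_max_right (T s) (4 ^ s * (k s : ℝ))
      have h3 : 0 ≤ 4 ^ s * (k s : ℝ) := by positivity
      refine ⟨y, by change _ ≤ |((e s).1 : E → ℝ) y|; linarith,
        by change _ ≤ |((e s).1 : E → ℝ) y|; linarith, fun z hz => ?_⟩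
      have h4 := Finset.single_le_sum (f := fun z => |g s z|) (fun z _ => abs_nonneg _) hz
      change _ < |((e s).1 : E → ℝ) y|
      linarith)
  have := isFiniteMeasure_atomicPart x sgn
  refine ⟨(atomicPart x sgn true).toSignedMeasure - (atomicPart x sgn false).toSignedMeasure,
    fun a t ha ht f hf => sIntegral_eq_zero_of_large _ fun β K => ?_⟩
  obtain ⟨n, hn⟩ := exists_nat_gt ((1 + |K|) * (3 / (2 * t)))
  obtain ⟨s, hs⟩ := he (⟨f, hf⟩, β, n)
  have hgs : g s = f := by simp [g, hs]
  have hks : k s = n := by simp [k, hs]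
  have hsg : sgn s = β := by simp [sgn, hs]
  obtain ⟨S, hS, hx1, hx2, hx3⟩ := hx s
  have hTs := hT s
  rw [hks] at hx2 hTs
  set B := {y | |g s (x s)| ≤ |g s y|} with hBdef
  have hB : MeasurableSet B := measurableSet_le measurable_const (hg s).abs
  have hxi : ∀ i < s, x i ∉ B := fun i hi h => absurd (hx3 _ (hS i hi)) (not_lt.2 h)
  have hown : (1 / 4 : ℝ) ^ s ≤ (atomicPart x sgn β).real B := by
    rw [← hsg]
    exact (ENNReal.ofReal_le_iff_le_toReal (measure_ne_top _ _)).1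
      (le_atomicPart_apply x sgn hB s (by rw [hBdef, Set.mem_ofPred_eq]))
  have hother : (atomicPart x sgn !β).real B ≤ (1 / 4 : ℝ) ^ s / 3 := by
    have := atomicPart_apply_le x sgn (!β) hB (s + 1) (by
      intro i hi hb
      rcases Nat.lt_succ_iff_lt_or_eq.1 hi with h | rfl
      · exact hxi i h
      · rw [hsg] at hb; simp at hb)
    refine (ENNReal.toReal_le_of_le_ofReal (by positivity) this).trans (le_of_eq ?_)
    rw [pow_succ]; ring
  have hμ : |μ B| ≤ (1 / 4) ^ s / (n + 1) := by
    refine (SignedMeasure.norm_le_totalVariation μ B).trans (le_trans ?_ hTs)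
    exact measureReal_mono (fun y hy => hx1.trans hy)
  refine ⟨B, hB, |g s (x s)|, abs_nonneg _, fun y hy => by rw [← hgs]; exact hy, ?_⟩
  have hv : (if β then (a • μ + t • ((atomicPart x sgn true).toSignedMeasure -
        (atomicPart x sgn false).toSignedMeasure)) B
      else -(a • μ + t • ((atomicPart x sgn true).toSignedMeasure -
        (atomicPart x sgn false).toSignedMeasure)) B) ≥
      t * ((1 / 4) ^ s * (2 / 3)) - (1 / 4) ^ s / (n + 1) := by
    have haμ : |a * μ B| ≤ (1 / 4) ^ s / (n + 1) := by
      rw [abs_mul]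
      nlinarith [abs_nonneg a, abs_nonneg (μ B)]
    have h5 := abs_le.1 haμ
    have h6 : t * ((1 / 4) ^ s * (2 / 3)) ≤
        t * ((atomicPart x sgn β).real B - (atomicPart x sgn !β).real B) := by
      apply mul_le_mul_of_nonneg_left _ ht.le
      linarith
    cases β
    · simp only [Bool.not_false] at h6
      simp [Measure.toSignedMeasure_apply_measurable hB]
      simp at h5 h6
      linarith
    · simp only [Bool.not_true] at h6
      simp [Measure.toSignedMeasure_apply_measurable hB]
      simp at h5 h6
      linarith
  have hn0 : (0 : ℝ) ≤ n := n.cast_nonneg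
  have hq : (0 : ℝ) < (1 / 4) ^ s := by positivity
  have hq4 : (4 : ℝ) ^ s * (1 / 4) ^ s = 1 := by rw [← mul_pow]; norm_num
  have hnt : 1 + |K| < n * (t * (2 / 3)) := by
    have : (1 + |K|) * (3 / (2 * t)) * (t * (2 / 3)) < n * (t * (2 / 3)) := by gcongr
    refine lt_of_eq_of_lt ?_ this
    field_simp
  have hn1 : (n : ℝ) / (n + 1) ≤ 1 := by
    rw [div_le_one (by positivity)]; linarith
  have hfac : t * ((1 / 4) ^ s * (2 / 3)) - (1 / 4) ^ s / (n + 1) =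
    (1 / 4) ^ s * (t * (2 / 3) - 1 / (n + 1)) := by ring
  have hpos : 0 ≤ t * (2 / 3) - 1 / ((n : ℝ) + 1) := by
    rw [sub_nonneg, div_le_iff₀ (by positivity)]
    nlinarith [abs_nonneg K]
  calc K ≤ |K| := le_abs_self K
    _ < n * (t * (2 / 3)) - n / (n + 1) := by linarith
    _ = (4 ^ s * n) * (t * ((1 / 4) ^ s * (2 / 3)) - (1 / 4) ^ s / (n + 1)) := by
        rw [hfac]
        linear_combination (-(n * (t * (2 / 3) - 1 / (n + 1)))) * hq4
    _ ≤ |g s (x s)| * (t * ((1 / 4) ^ s * (2 / 3)) - (1 / 4) ^ s / (n + 1)) := by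
        refine mul_le_mul_of_nonneg_right hx2 ?_
        rw [hfac]; exact mul_nonneg hq.le hpos
    _ ≤ _ := mul_le_mul_of_nonneg_left hv (abs_nonneg _)

theorem integrable_of_bounded {E : Type*} [MeasurableSpace E] (m : Measure E) [IsFiniteMeasure m]
    {f : E → ℝ} (hf : Measurable f) (hb : ∃ B : ℝ, ∀ x, |f x| ≤ B) : Integrable f m := by
  obtain ⟨B, hB⟩ := hb
  exact Integrable.of_bound hf.aestronglyMeasurable B (Eventually.of_forall hB)

theorem sIntegral_of_eq_sub {E : Type*} [MeasurableSpace E] {σ : SignedMeasure E}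
    {a b : Measure E} [IsFiniteMeasure a] [IsFiniteMeasure b]
    (h : σ = a.toSignedMeasure - b.toSignedMeasure)
    {f : E → ℝ} (hf : Measurable f) (hb : ∃ B : ℝ, ∀ x, |f x| ≤ B) :
    sIntegral σ f = ∫ x, f x ∂a - ∫ x, f x ∂b := by
  have h1 : σ.toJordanDecomposition.posPart + b = a + σ.toJordanDecomposition.negPart := by
    rw [← Measure.toSignedMeasure_eq_toSignedMeasure_iff, Measure.toSignedMeasure_add,
      Measure.toSignedMeasure_add]
    have h2 := σ.toSignedMeasure_toJordanDecomposition
    rw [JordanDecomposition.toSignedMeasure] at h2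
    rw [← sub_eq_sub_iff_add_eq_add, h2, h]
  have h3 := congrArg (fun m => ∫ x, f x ∂m) h1
  rw [integral_add_measure (integrable_of_bounded _ hf hb) (integrable_of_bounded _ hf hb),
    integral_add_measure (integrable_of_bounded _ hf hb) (integrable_of_bounded _ hf hb)] at h3
  rw [sIntegral]
  linarith

theorem signedMeasure_eq_posPart_sub_negPart {E : Type*} [MeasurableSpace E]
    (σ : SignedMeasure E) :
    σ = σ.toJordanDecomposition.posPart.toSignedMeasure -
      σ.toJordanDecomposition.negPart.toSignedMeasure :=
  σ.toSignedMeasure_toJordanDecomposition.symm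

theorem sIntegral_add {E : Type*} [MeasurableSpace E] (σ τ : SignedMeasure E)
    {f : E → ℝ} (hf : Measurable f) (hb : ∃ B : ℝ, ∀ x, |f x| ≤ B) :
    sIntegral (σ + τ) f = sIntegral σ f + sIntegral τ f := by
  have h : σ + τ = (σ.toJordanDecomposition.posPart +
      τ.toJordanDecomposition.posPart).toSignedMeasure -
      (σ.toJordanDecomposition.negPart + τ.toJordanDecomposition.negPart).toSignedMeasure := by
    rw [Measure.toSignedMeasure_add, Measure.toSignedMeasure_add, add_sub_add_comm,
      ← signedMeasure_eq_posPart_sub_negPart, ← signedMeasure_eq_posPart_sub_negPart]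
  rw [sIntegral_of_eq_sub h hf hb,
    integral_add_measure (integrable_of_bounded _ hf hb) (integrable_of_bounded _ hf hb),
    integral_add_measure (integrable_of_bounded _ hf hb) (integrable_of_bounded _ hf hb),
    sIntegral, sIntegral]
  ring

theorem sIntegral_smul {E : Type*} [MeasurableSpace E] (r : ℝ) (σ : SignedMeasure E)
    (f : E → ℝ) : sIntegral (r • σ) f = r * sIntegral σ f := by
  rw [sIntegral, sIntegral, SignedMeasure.toJordanDecomposition_smul_real]
  rcases le_or_gt 0 r with hr | hr
  · rw [JordanDecomposition.real_smul_posPart_nonneg _ _ hr,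
      JordanDecomposition.real_smul_negPart_nonneg _ _ hr, integral_smul_nnreal_measure,
      integral_smul_nnreal_measure, NNReal.smul_def, NNReal.smul_def, Real.coe_toNNReal _ hr,
      smul_eq_mul, smul_eq_mul]
    ring
  · rw [JordanDecomposition.real_smul_posPart_neg _ _ hr,
      JordanDecomposition.real_smul_negPart_neg _ _ hr, integral_smul_nnreal_measure,
      integral_smul_nnreal_measure, NNReal.smul_def, NNReal.smul_def,
      Real.coe_toNNReal _ (neg_nonneg.2 hr.le), smul_eq_mul, smul_eq_mul]
    ring

theorem sIntegral_sub {E : Type*} [MeasurableSpace E] (σ τ : SignedMeasure E)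
    {f : E → ℝ} (hf : Measurable f) (hb : ∃ B : ℝ, ∀ x, |f x| ≤ B) :
    sIntegral (σ - τ) f = sIntegral σ f - sIntegral τ f := by
  have h : σ - τ = σ + (-1 : ℝ) • τ := by
    ext B hB
    simp [sub_eq_add_neg]
  rw [h, sIntegral_add _ _ hf hb, sIntegral_smul]
  ring

theorem sIntegral_toSignedMeasure {E : Type*} [MeasurableSpace E] (m : Measure E)
    [IsFiniteMeasure m] {f : E → ℝ} (hf : Measurable f) (hb : ∃ B : ℝ, ∀ x, |f x| ≤ B) :
    sIntegral m.toSignedMeasure f = ∫ x, f x ∂m := by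
  rw [sIntegral_of_eq_sub (a := m) (b := 0) (by simp) hf hb]
  simp

theorem sIntegral_sum_dirac {E ι : Type*} [MeasurableSpace E] (s : Finset ι) (x : ι → E)
    {f : E → ℝ} (hf : Measurable f) (hb : ∃ B : ℝ, ∀ x, |f x| ≤ B) :
    sIntegral (∑ i ∈ s, (Measure.dirac (x i)).toSignedMeasure) f = ∑ i ∈ s, f (x i) := by
  classical
  induction s using Finset.induction_on with
  | empty =>
    have := sIntegral_smul 0 (0 : SignedMeasure E) f
    simpa using this
  | insert i s hi ih =>
    rw [Finset.sum_insert hi, Finset.sum_insert hi, sIntegral_add _ _ hf hb, ih,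
      sIntegral_toSignedMeasure _ hf hb, integral_dirac' _ _ hf.stronglyMeasurable]

/-- A seminorm dominated by a weighted sum of moments is dominated by the part of the sum that
ranges over the bounded functions of the family. -/
theorem seminorm_le_tsum_bounded {E : Type*} [MeasurableSpace E] (N : SignedMeasure E → ℝ)
    (hN_smul : ∀ (a : ℝ) (ν : SignedMeasure E), N (a • ν) = |a| * N ν)
    (hN_add : ∀ ν₁ ν₂ : SignedMeasure E, N (ν₁ + ν₂) ≤ N ν₁ + N ν₂)
    (F : Set (E → ℝ)) (hFcount : F.Countable) (hFmeas : ∀ f ∈ F, Measurable f)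
    (d : (E → ℝ) → ℝ) (hd : ∀ f ∈ F, 0 < d f)
    (hNle : ∀ ν : SignedMeasure E, N ν ≤ ∑' f : F, d f * |sIntegral ν f|)
    (μ : SignedMeasure E)
    (hμ : Summable fun f : {f | f ∈ F ∧ ∃ B : ℝ, ∀ x, |f x| ≤ B} => d f * |sIntegral μ f|) :
    N μ ≤ ∑' f : {f | f ∈ F ∧ ∃ B : ℝ, ∀ x, |f x| ≤ B}, d f * |sIntegral μ f| := by
  set Fb := {f : E → ℝ | f ∈ F ∧ ∃ B : ℝ, ∀ x, |f x| ≤ B} with hFb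
  let G := {f : E → ℝ | f ∈ F ∧ ¬ ∃ B : ℝ, ∀ x, |f x| ≤ B}
  obtain ⟨ν, hν⟩ := exists_signedMeasure_sIntegral_eq_zero G (hFcount.mono fun f hf => hf.1)
    (fun f hf => hFmeas f hf.1) (fun f hf B => by
      by_contra! h
      exact hf.2 ⟨B, h⟩) μ
  have hFbm : ∀ f : Fb, Measurable (f : E → ℝ) := fun f => hFmeas _ f.2.1
  have hdb : ∀ f : Fb, 0 ≤ d f := fun f => (hd _ f.2.1).le
  have key : ∀ a t : ℝ, |a| ≤ 1 → 0 < t →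
      N (a • μ + t • ν) ≤ ∑' f : Fb, d f * |a * sIntegral μ f + t * sIntegral ν f| := by
    intro a t ha ht
    have h1 : ∑' f : F, d f * |sIntegral (a • μ + t • ν) f| =
        ∑' f : Fb, d f * |sIntegral (a • μ + t • ν) f| := by
      rw [tsum_subtype F fun f => d f * |sIntegral (a • μ + t • ν) f|,
        tsum_subtype Fb fun f => d f * |sIntegral (a • μ + t • ν) f|]
      congr 1
      ext f
      by_cases hF : f ∈ F
      · by_cases hB : ∃ B : ℝ, ∀ x, |f x| ≤ B
        · rw [Set.indicator_of_mem hF, Set.indicator_of_mem (show f ∈ Fb from ⟨hF, hB⟩)]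
        · rw [Set.indicator_of_mem hF, Set.indicator_of_notMem (fun h : f ∈ Fb => hB h.2),
            hν a t ha ht f ⟨hF, hB⟩, abs_zero, mul_zero]
      · rw [Set.indicator_of_notMem hF, Set.indicator_of_notMem (fun h : f ∈ Fb => hF h.1)]
    refine (hNle _).trans (le_of_eq (h1.trans (tsum_congr fun f => ?_)))
    rw [sIntegral_add _ _ (hFbm f) f.2.2, sIntegral_smul, sIntegral_smul]
  have htri : ∀ t : ℝ, 0 < t → N μ ≤ N ((1 : ℝ) • μ + t • ν) + t * N ν := by
    intro t ht
    have h1 : μ = ((1 : ℝ) • μ + t • ν) + (-t) • ν := by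
      ext B hB
      simp
    calc N μ = N (((1 : ℝ) • μ + t • ν) + (-t) • ν) := by rw [← h1]
      _ ≤ N ((1 : ℝ) • μ + t • ν) + N ((-t) • ν) := hN_add _ _
      _ = _ := by rw [hN_smul, abs_neg, abs_of_pos ht]
  have hNν : N ν ≤ ∑' f : Fb, d f * |sIntegral ν f| := by
    have := key 0 1 (by simp) one_pos
    simpa using this
  by_cases hs : Summable fun f : Fb => d f * |sIntegral ν f|
  · refine le_of_forall_pos_le_add fun ε hε => ?_
    set S := ∑' f : Fb, d f * |sIntegral ν f| with hS
    have hS0 : 0 ≤ S := tsum_nonneg fun f => mul_nonneg (hdb f) (abs_nonneg _)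
    set t := ε / (2 * (S + 1)) with ht
    have ht0 : 0 < t := by positivity
    have h2 : ∑' f : Fb, d f * |1 * sIntegral μ f + t * sIntegral ν f| ≤
        ∑' f : Fb, d f * |sIntegral μ f| + t * S := by
      rw [hS, ← tsum_mul_left, ← hμ.tsum_add (hs.mul_left t)]
      have hle : ∀ f : Fb, d f * |1 * sIntegral μ f + t * sIntegral ν f| ≤
          d f * |sIntegral μ f| + t * (d f * |sIntegral ν f|) := by
        intro f
        have := abs_add_le (1 * sIntegral μ f) (t * sIntegral ν f)
        rw [abs_mul t, abs_of_pos ht0, one_mul] at this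
        calc _ ≤ d f * (|sIntegral μ f| + t * |sIntegral ν f|) := by
              rw [one_mul]; exact mul_le_mul_of_nonneg_left this (hdb f)
          _ = _ := by ring
      have hsum := hμ.add (hs.mul_left t)
      exact (Summable.of_nonneg_of_le (fun f => mul_nonneg (hdb f) (abs_nonneg _)) hle
        hsum).tsum_le_tsum hle hsum
    have h3 := key 1 t (by simp) ht0
    have h4 := htri t ht0
    have h5 : t * N ν ≤ t * S := mul_le_mul_of_nonneg_left hNν ht0.le
    have h6 : 2 * (t * S) ≤ ε := by
      have : ε = 2 * (t * (S + 1)) := by rw [ht]; field_simp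
      nlinarith
    linarith
  · have h1 : ¬ Summable fun f : Fb => d f * |1 * sIntegral μ f + 1 * sIntegral ν f| := by
      intro h
      apply hs
      refine Summable.of_nonneg_of_le (fun f => mul_nonneg (hdb f) (abs_nonneg _)) (fun f => ?_)
        (h.add hμ)
      rw [← mul_add]
      refine mul_le_mul_of_nonneg_left ?_ (hdb f)
      have := abs_sub (1 * sIntegral μ f + 1 * sIntegral ν f) (sIntegral μ f)
      simpa using this
    have h2 := key 1 1 (by simp) one_pos
    rw [tsum_eq_zero_of_not_summable h1] at h2
    rw [tsum_eq_zero_of_not_summable hs] at hNν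
    have h3 := htri 1 one_pos
    have h4 : 0 ≤ ∑' f : Fb, d f * |sIntegral μ f| :=
      tsum_nonneg fun f => mul_nonneg (hdb f) (abs_nonneg _)
    linarith

/-- Dyadic bound for `max_{k < 2 ^ J} |S k|`. -/
noncomputable def dyadicChain (S : ℕ → ℝ) (J : ℕ) : ℝ :=
  ∑ j ∈ Finset.range J,
    √(∑ i ∈ Finset.range (2 ^ (J - j)), (S ((i + 1) * 2 ^ j) - S (i * 2 ^ j)) ^ 2)

theorem dyadicChain_nonneg (S : ℕ → ℝ) (J : ℕ) : 0 ≤ dyadicChain S J :=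
  Finset.sum_nonneg fun _ _ => Real.sqrt_nonneg _

theorem abs_le_dyadicChain (J : ℕ) : ∀ (S : ℕ → ℝ), S 0 = 0 → ∀ k < 2 ^ J,
    |S k| ≤ dyadicChain S J := by
  induction J with
  | zero =>
    intro S hS k hk
    have : k = 0 := by simpa using hk
    simp [this, hS, dyadicChain]
  | succ J ih =>
    intro S hS k hk
    have hstep : dyadicChain S (J + 1) = dyadicChain (fun i => S (2 * i)) J +
        √(∑ i ∈ Finset.range (2 ^ (J + 1)), (S (i + 1) - S i) ^ 2) := by
      rw [dyadicChain, Finset.sum_range_succ', dyadicChain]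
      congr 1
      · refine Finset.sum_congr rfl fun j _ => ?_
        rw [Nat.add_sub_add_right]
        congr 1
        refine Finset.sum_congr rfl fun i _ => ?_
        congr 3
        · ring
        · ring
      · simp
    have h1 := ih (fun i => S (2 * i)) (by simpa using hS) (k / 2) (by
      rw [pow_succ] at hk; omega)
    have h2 : |S k - S (2 * (k / 2))| ≤
        √(∑ i ∈ Finset.range (2 ^ (J + 1)), (S (i + 1) - S i) ^ 2) := by
      rcases Nat.mod_two_eq_zero_or_one k with hk2 | hk2
      · rw [show 2 * (k / 2) = k by omega, sub_self, abs_zero]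
        exact Real.sqrt_nonneg _
      · apply Real.abs_le_sqrt
        have := Finset.single_le_sum (f := fun i => (S (i + 1) - S i) ^ 2)
          (fun i _ => sq_nonneg _) (Finset.mem_range.2 (show 2 * (k / 2) < 2 ^ (J + 1) by omega))
        rwa [show 2 * (k / 2) + 1 = k by omega] at this
    rw [hstep]
    calc |S k| = |S (2 * (k / 2)) + (S k - S (2 * (k / 2)))| := by rw [add_sub_cancel]
      _ ≤ |S (2 * (k / 2))| + |S k - S (2 * (k / 2))| := abs_add_le _ _
      _ ≤ _ := add_le_add h1 h2

theorem integrable_sqrt {Ω : Type*} [MeasurableSpace Ω] (m : Measure Ω) [IsFiniteMeasure m]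
    {g : Ω → ℝ} (hg : Integrable g m) : Integrable (fun ω => √(g ω)) m := by
  refine Integrable.mono' ((integrable_const 1).add hg.abs)
    (Real.continuous_sqrt.comp_aestronglyMeasurable hg.aestronglyMeasurable)
    (Eventually.of_forall fun ω => ?_)
  rw [Real.norm_eq_abs, abs_of_nonneg (Real.sqrt_nonneg _)]
  refine (Real.sqrt_le_sqrt (le_abs_self _)).trans ?_
  change √|g ω| ≤ 1 + |g ω|
  nlinarith [Real.sq_sqrt (abs_nonneg (g ω)), sq_nonneg (√|g ω| - 1), Real.sqrt_nonneg |g ω|]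

theorem integral_sqrt_le {Ω : Type*} [MeasurableSpace Ω] (m : Measure Ω) [IsProbabilityMeasure m]
    {g : Ω → ℝ} (hg : Integrable g m) (h0 : ∀ ω, 0 ≤ g ω) :
    ∫ ω, √(g ω) ∂m ≤ √(∫ ω, g ω ∂m) :=
  Real.strictConcaveOn_sqrt.concaveOn.le_map_integral Real.continuous_sqrt.continuousOn isClosed_Ici
    (Eventually.of_forall h0) hg (integrable_sqrt m hg)

theorem sum_pow_le_of_one_lt {q : ℝ} (hq : 1 < q) (J : ℕ) :
    ∑ j ∈ Finset.range J, q ^ j ≤ q ^ J / (q - 1) := by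
  rw [geom_sum_eq hq.ne']
  have : 0 < q - 1 := by linarith
  gcongr
  linarith

theorem integrable_sq_partialSum_sub {Ω : Type*} [MeasurableSpace Ω] (m : Measure Ω)
    {Z : ℕ → Ω → ℝ} (hZ : ∀ i, MemLp (Z i) 2 m) (a b : ℕ) :
    Integrable (fun ω => (∑ l ∈ Finset.range a, Z l ω - ∑ l ∈ Finset.range b, Z l ω) ^ 2) m :=
  ((memLp_finsetSum _ fun i _ => hZ i).sub (memLp_finsetSum _ fun i _ => hZ i)).integrable_sq

theorem integrable_dyadicChain {Ω : Type*} [MeasurableSpace Ω] (m : Measure Ω)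
    [IsFiniteMeasure m] {Z : ℕ → Ω → ℝ} (hZ : ∀ i, MemLp (Z i) 2 m) (J : ℕ) :
    Integrable (fun ω => dyadicChain (fun k => ∑ l ∈ Finset.range k, Z l ω) J) m :=
  integrable_finsetSum _ fun _ _ => integrable_sqrt m
    (integrable_finsetSum _ fun _ _ => integrable_sq_partialSum_sub m hZ _ _)

theorem integral_dyadicChain_le {Ω : Type*} [MeasurableSpace Ω] (m : Measure Ω)
    [IsProbabilityMeasure m] {Z : ℕ → Ω → ℝ} (hZ : ∀ i, MemLp (Z i) 2 m) {A α : ℝ} (hA : 0 ≤ A)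
    (hα : 1 < α)
    (hvar : ∀ a h : ℕ, ∫ ω, (∑ l ∈ Finset.range (a + h), Z l ω - ∑ l ∈ Finset.range a, Z l ω) ^ 2 ∂m
      ≤ A * (h : ℝ) ^ α) (J : ℕ) :
    ∫ ω, dyadicChain (fun k => ∑ l ∈ Finset.range k, Z l ω) J ∂m ≤
      √A * (((2 : ℝ) ^ (α / 2)) ^ J / ((2 : ℝ) ^ ((α - 1) / 2) - 1)) := by
  set q : ℝ := (2 : ℝ) ^ ((α - 1) / 2) with hq
  have hq1 : 1 < q := Real.one_lt_rpow (by norm_num) (by linarith)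
  have hpq : (2 : ℝ) ^ (α / 2) = √2 * q := by
    rw [hq, Real.sqrt_eq_rpow, ← Real.rpow_add (by norm_num)]
    congr 1; ring
  have hterm : ∀ j ∈ Finset.range J,
      ∫ ω, √(∑ i ∈ Finset.range (2 ^ (J - j)),
        (∑ l ∈ Finset.range ((i + 1) * 2 ^ j), Z l ω - ∑ l ∈ Finset.range (i * 2 ^ j), Z l ω) ^ 2)
        ∂m ≤ √A * √2 ^ J * q ^ j := by
    intro j hj
    have hjJ := Finset.mem_range.1 hj
    refine (integral_sqrt_le m
      (integrable_finsetSum _ fun _ _ => integrable_sq_partialSum_sub m hZ _ _)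
      (fun ω => Finset.sum_nonneg fun _ _ => sq_nonneg _)).trans ?_
    rw [integral_finsetSum _ fun _ _ => integrable_sq_partialSum_sub m hZ _ _]
    apply Real.sqrt_le_iff.2
    refine ⟨by positivity, ?_⟩
    have hb : ∀ i ∈ Finset.range (2 ^ (J - j)), ∫ ω, (∑ l ∈ Finset.range ((i + 1) * 2 ^ j), Z l ω -
        ∑ l ∈ Finset.range (i * 2 ^ j), Z l ω) ^ 2 ∂m ≤ A * ((2 : ℝ) ^ j) ^ α := by
      intro i _
      have := hvar (i * 2 ^ j) (2 ^ j)
      rw [← Nat.succ_mul] at this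
      exact_mod_cast this
    refine (Finset.sum_le_card_nsmul _ _ _ hb).trans (le_of_eq ?_)
    have h1 : ((2 : ℝ) ^ j) ^ α = 2 ^ j * (q ^ j) ^ 2 := by
      rw [hq, ← Real.rpow_natCast, ← Real.rpow_natCast, ← Real.rpow_natCast,
        ← Real.rpow_mul (by positivity), ← Real.rpow_mul (by positivity),
        ← Real.rpow_mul (by positivity), ← Real.rpow_add (by norm_num)]
      congr 1; push_cast; ring
    have h2 : (2 : ℝ) ^ (J - j) * 2 ^ j = 2 ^ J := by
      rw [← pow_add, Nat.sub_add_cancel hjJ.le]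
    have h3 : (√2 ^ J : ℝ) ^ 2 = 2 ^ J := by
      rw [← pow_mul, mul_comm, pow_mul, Real.sq_sqrt (by norm_num)]
    rw [Finset.card_range, nsmul_eq_mul, h1, mul_pow, mul_pow, Real.sq_sqrt hA, h3, ← h2]
    push_cast; ring
  have hsum : ∫ ω, dyadicChain (fun k => ∑ l ∈ Finset.range k, Z l ω) J ∂m ≤
      ∑ j ∈ Finset.range J, √A * √2 ^ J * q ^ j := by
    unfold dyadicChain
    rw [integral_finsetSum _ fun _ _ => integrable_sqrt m
      (integrable_finsetSum _ fun _ _ => integrable_sq_partialSum_sub m hZ _ _)]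
    exact Finset.sum_le_sum hterm
  refine hsum.trans ?_
  rw [← Finset.mul_sum, hpq, mul_pow]
  calc _ ≤ √A * √2 ^ J * (q ^ J / (q - 1)) := by
        gcongr
        exact sum_pow_le_of_one_lt hq1 J
    _ = _ := by ring

theorem sum_rpow_neg_le {r : ℝ} (hr : r < 1) :
    ∃ K : ℝ, 0 ≤ K ∧ ∀ h : ℕ, ∑ i ∈ Finset.range h, ((i + 1 : ℕ) : ℝ) ^ (-r) ≤
      K * (h : ℝ) ^ (1 - r) := by
  rcases le_or_gt r 0 with h0 | h0
  · refine ⟨1, zero_le_one, fun h => ?_⟩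
    rcases Nat.eq_zero_or_pos h with rfl | hh
    · rw [Finset.range_zero, Finset.sum_empty]; positivity
    · have hb : ∀ i ∈ Finset.range h, ((i + 1 : ℕ) : ℝ) ^ (-r) ≤ (h : ℝ) ^ (-r) := fun i hi =>
        Real.rpow_le_rpow (by positivity) (by exact_mod_cast Finset.mem_range.1 hi) (by linarith)
      refine (Finset.sum_le_card_nsmul _ _ _ hb).trans (le_of_eq ?_)
      rw [Finset.card_range, nsmul_eq_mul, one_mul, sub_eq_add_neg,
        Real.rpow_add (by exact_mod_cast hh), Real.rpow_one]
  · have h1r : 0 < 1 - r := by linarith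
    refine ⟨1 / (1 - r), by positivity, fun h => ?_⟩
    induction h with
    | zero => rw [Finset.range_zero, Finset.sum_empty]; positivity
    | succ h ih =>
      rw [Finset.sum_range_succ]
      have hx : (0 : ℝ) < ((h + 1 : ℕ) : ℝ) := by positivity
      set x : ℝ := ((h + 1 : ℕ) : ℝ) with hxdef
      have hhx : (h : ℝ) = x - 1 := by rw [hxdef]; push_cast; ring
      have hx1 : 1 ≤ x := by rw [hxdef]; push_cast; linarith [(h.cast_nonneg : (0 : ℝ) ≤ h)]
      have hB := rpow_one_add_le_one_add_mul_self (s := -(1 / x))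
        (by rw [neg_le_neg_iff, div_le_one hx]; exact hx1) h1r.le (by linarith)
      have hfac : (h : ℝ) ^ (1 - r) = x ^ (1 - r) * (1 + -(1 / x)) ^ (1 - r) := by
        rw [← Real.mul_rpow hx.le (by
          rw [← sub_eq_add_neg, sub_nonneg, div_le_one hx]; exact hx1)]
        congr 1
        rw [hhx]; field_simp; ring
      have hxr : x ^ (1 - r) = x * x ^ (-r) := by
        rw [sub_eq_add_neg, Real.rpow_add hx, Real.rpow_one]
      have hxr0 : 0 < x ^ (-r) := Real.rpow_pos_of_pos hx _
      have hle : (h : ℝ) ^ (1 - r) ≤ x ^ (1 - r) - (1 - r) * x ^ (-r) := by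
        rw [hfac]
        refine (mul_le_mul_of_nonneg_left hB (by positivity)).trans (le_of_eq ?_)
        rw [hxr]; field_simp; ring
      calc _ ≤ 1 / (1 - r) * (h : ℝ) ^ (1 - r) + x ^ (-r) := by gcongr
        _ ≤ 1 / (1 - r) * (x ^ (1 - r) - (1 - r) * x ^ (-r)) + x ^ (-r) := by gcongr
        _ = _ := by field_simp; ring

/-- Variance of block sums under algebraic decay of correlations. -/
theorem integral_sq_partialSum_sub_le {C r : ℝ} (hC : 0 ≤ C) (hr : r < 1) :
    ∃ K : ℝ, 0 ≤ K ∧ ∀ {Ω : Type*} [MeasurableSpace Ω] (m : Measure Ω) (Z : ℕ → Ω → ℝ) (V : ℝ),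
      0 ≤ V → (∀ i, MemLp (Z i) 2 m) → (∀ i, ∫ ω, Z i ω ^ 2 ∂m ≤ V) →
      (∀ i k : ℕ, 1 ≤ k → |∫ ω, Z i ω * Z (i + k) ω ∂m| ≤ C * (k : ℝ) ^ (-r) * V) →
      ∀ a h : ℕ, ∫ ω, (∑ l ∈ Finset.range (a + h), Z l ω - ∑ l ∈ Finset.range a, Z l ω) ^ 2 ∂m
        ≤ K * V * (h : ℝ) ^ (2 - r) := by
  obtain ⟨K₁, hK₁, hsum⟩ := sum_rpow_neg_le hr
  refine ⟨1 + 2 * C * K₁, by positivity, fun m Z V hV hZ hvar hcov a h => ?_⟩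
  have hH : ∀ h : ℕ, 0 ≤ ∑ i ∈ Finset.range h, ((i + 1 : ℕ) : ℝ) ^ (-r) := fun h =>
    Finset.sum_nonneg fun i _ => by positivity
  have key : ∀ h : ℕ,
      ∫ ω, (∑ l ∈ Finset.range (a + h), Z l ω - ∑ l ∈ Finset.range a, Z l ω) ^ 2 ∂m ≤
      h * (V * (1 + 2 * C * ∑ i ∈ Finset.range h, ((i + 1 : ℕ) : ℝ) ^ (-r))) := by
    intro h
    induction h with
    | zero => simp
    | succ h ih =>
      have hexp : ∀ ω, (∑ l ∈ Finset.range (a + (h + 1)), Z l ω - ∑ l ∈ Finset.range a, Z l ω) ^ 2 =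
          (∑ l ∈ Finset.range (a + h), Z l ω - ∑ l ∈ Finset.range a, Z l ω) ^ 2 +
          (2 * ∑ i ∈ Finset.range h, Z (a + i) ω * Z (a + h) ω + Z (a + h) ω ^ 2) := by
        intro ω
        rw [← add_assoc, Finset.sum_range_succ, Finset.sum_range_add, ← Finset.sum_mul]
        ring
      have hcr : ∀ i j, Integrable (fun ω => Z i ω * Z j ω) m := fun i j =>
        (hZ i).integrable_mul (hZ j)
      have hcs : Integrable (fun ω => ∑ i ∈ Finset.range h, Z (a + i) ω * Z (a + h) ω) m :=
        integrable_finsetSum _ fun i _ => hcr _ _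
      have hcs2 : Integrable (fun ω => 2 * ∑ i ∈ Finset.range h, Z (a + i) ω * Z (a + h) ω +
          Z (a + h) ω ^ 2) m := (hcs.const_mul 2).add (hZ _).integrable_sq
      simp_rw [hexp]
      rw [integral_add (integrable_sq_partialSum_sub m hZ _ _)
        hcs2,
        integral_add (hcs.const_mul 2) (hZ _).integrable_sq, integral_const_mul,
        integral_finsetSum _ fun i _ => hcr _ _]
      have hc : ∑ i ∈ Finset.range h, ∫ ω, Z (a + i) ω * Z (a + h) ω ∂m ≤
          C * V * ∑ i ∈ Finset.range h, ((i + 1 : ℕ) : ℝ) ^ (-r) := by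
        rw [← Finset.sum_range_reflect (fun i => ((i + 1 : ℕ) : ℝ) ^ (-r)), Finset.mul_sum]
        refine Finset.sum_le_sum fun i hi => ?_
        have hi' := Finset.mem_range.1 hi
        have := (le_abs_self _).trans (hcov (a + i) (h - i) (by omega))
        rw [show a + i + (h - i) = a + h by omega] at this
        rw [show h - 1 - i + 1 = h - i by omega]
        linarith
      have hmono : ∑ i ∈ Finset.range h, ((i + 1 : ℕ) : ℝ) ^ (-r) ≤
          ∑ i ∈ Finset.range (h + 1), ((i + 1 : ℕ) : ℝ) ^ (-r) := by
        rw [Finset.sum_range_succ]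
        have : 0 ≤ ((h + 1 : ℕ) : ℝ) ^ (-r) := by positivity
        linarith
      have hv := hvar (a + h)
      set H := ∑ i ∈ Finset.range h, ((i + 1 : ℕ) : ℝ) ^ (-r)
      set H' := ∑ i ∈ Finset.range (h + 1), ((i + 1 : ℕ) : ℝ) ^ (-r)
      have hstep : (h + 1 : ℕ) * (V * (1 + 2 * C * H)) ≤ (h + 1 : ℕ) * (V * (1 + 2 * C * H')) := by
        gcongr
      refine le_trans ?_ hstep
      push_cast
      nlinarith
  refine (key h).trans ?_
  rcases Nat.eq_zero_or_pos h with rfl | hh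
  · simp only [Nat.cast_zero, zero_mul]; positivity
  have hh1 : (1 : ℝ) ≤ h := by exact_mod_cast hh
  have hone : (1 : ℝ) ≤ (h : ℝ) ^ (1 - r) := Real.one_le_rpow hh1 (by linarith)
  have hpow : (h : ℝ) ^ (2 - r) = h * (h : ℝ) ^ (1 - r) := by
    rw [show 2 - r = 1 + (1 - r) by ring, Real.rpow_add (by linarith), Real.rpow_one]
  have h1 : 1 + 2 * C * ∑ i ∈ Finset.range h, ((i + 1 : ℕ) : ℝ) ^ (-r) ≤
      (1 + 2 * C * K₁) * (h : ℝ) ^ (1 - r) := by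
    have := mul_le_mul_of_nonneg_left (hsum h) (by positivity : 0 ≤ 2 * C)
    nlinarith
  calc _ ≤ h * (V * ((1 + 2 * C * K₁) * (h : ℝ) ^ (1 - r))) := by gcongr
    _ = _ := by rw [hpow]; ring

/-- The order of the fluctuations of the weighted empirical process. -/
noncomputable def noiseRate (γ r : ℝ) (n : ℕ) : ℝ :=
  (n : ℝ) ^ (-r / 2) * (1 + Real.log n * (if γ - 1 + r / 2 = 0 then (1 : ℝ) else 0)) +
    (n : ℝ) ^ (γ - 1)

theorem noiseRate_nonneg (γ r : ℝ) (n : ℕ) : 0 ≤ noiseRate γ r n := by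
  have := Real.log_natCast_nonneg n
  unfold noiseRate
  split_ifs <;> positivity

theorem sum_rpow_le_noiseRate (γ r : ℝ) :
    ∃ K : ℝ, 0 ≤ K ∧ ∀ n : ℕ, 1 ≤ n →
      ∑ l ∈ Finset.range (Nat.log 2 n + 1), ((2 : ℝ) ^ (1 - r / 2 - γ)) ^ l ≤
        K * ((n : ℝ) ^ (1 - γ) * noiseRate γ r n) := by
  set y : ℝ := (2 : ℝ) ^ (1 - r / 2 - γ) with hy
  have hy0 : 0 < y := Real.rpow_pos_of_pos (by norm_num) _
  have hsplit : ∀ n : ℕ, 1 ≤ n → (n : ℝ) ^ (1 - γ) * noiseRate γ r n =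
      (n : ℝ) ^ (1 - r / 2 - γ) *
        (1 + Real.log n * (if γ - 1 + r / 2 = 0 then (1 : ℝ) else 0)) + 1 := by
    intro n hn
    have hn0 : (0 : ℝ) < n := by exact_mod_cast hn
    rw [noiseRate, mul_add, ← mul_assoc, ← Real.rpow_add hn0, ← Real.rpow_add hn0]
    rw [show 1 - γ + (γ - 1) = 0 by ring, Real.rpow_zero,
      show 1 - γ + -r / 2 = 1 - r / 2 - γ by ring]
  rcases lt_trichotomy (1 - r / 2 - γ) 0 with h | h | h
  · have hy1 : y < 1 := Real.rpow_lt_one_of_one_lt_of_neg (by norm_num) h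
    refine ⟨1 / (1 - y), by rw [one_div_nonneg]; linarith, fun n hn => ?_⟩
    rw [hsplit n hn, if_neg (by linarith), mul_zero, add_zero, mul_one]
    have h1 : ∑ l ∈ Finset.range (Nat.log 2 n + 1), y ^ l ≤ 1 / (1 - y) := by
      rw [one_div, ← tsum_geometric_of_lt_one hy0.le hy1]
      exact (summable_geometric_of_lt_one hy0.le hy1).sum_le_tsum _ fun _ _ => by positivity
    have h2 : 0 ≤ (n : ℝ) ^ (1 - r / 2 - γ) := by positivity
    have h3 : 0 ≤ 1 / (1 - y) := by rw [one_div_nonneg]; linarith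
    nlinarith
  · refine ⟨2, by norm_num, fun n hn => ?_⟩
    have hn0 : (n : ℝ) ≠ 0 := by positivity
    rw [hsplit n hn, if_pos (by linarith), mul_one, hy, h, Real.rpow_zero, Real.rpow_zero]
    simp only [one_pow, Finset.sum_const, Finset.card_range, nsmul_eq_mul, mul_one, one_mul]
    have h1 : (Nat.log 2 n : ℝ) * Real.log 2 ≤ Real.log n := by
      rw [← Real.log_pow]
      apply Real.log_le_log (by positivity)
      exact_mod_cast Nat.pow_log_le_self 2 (by omega)
    have h2 := Real.log_two_gt_d9
    have h3 : (0 : ℝ) ≤ (Nat.log 2 n : ℝ) := Nat.cast_nonneg _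
    push_cast
    nlinarith
  · have hy1 : 1 < y := Real.one_lt_rpow (by norm_num) h
    refine ⟨y / (y - 1), div_nonneg hy0.le (by linarith), fun n hn => ?_⟩
    rw [hsplit n hn, if_neg (by linarith), mul_zero, add_zero, mul_one]
    have h1 := sum_pow_le_of_one_lt hy1 (Nat.log 2 n + 1)
    have h2 : y ^ (Nat.log 2 n) ≤ (n : ℝ) ^ (1 - r / 2 - γ) := by
      rw [hy, ← Real.rpow_natCast, ← Real.rpow_mul (by norm_num), mul_comm, Real.rpow_mul
        (by norm_num), Real.rpow_natCast]
      apply Real.rpow_le_rpow (by positivity) _ h.le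
      exact_mod_cast Nat.pow_log_le_self 2 (by omega)
    have h3 : 0 < y - 1 := by linarith
    calc _ ≤ y ^ (Nat.log 2 n + 1) / (y - 1) := h1
      _ = y / (y - 1) * y ^ (Nat.log 2 n) := by rw [pow_succ]; ring
      _ ≤ y / (y - 1) * ((n : ℝ) ^ (1 - r / 2 - γ) + 1) := by
        apply mul_le_mul_of_nonneg_left _ (by positivity)
        linarith

/-- Weighted maximal inequality for partial sums under algebraic decay of correlations. -/
theorem exists_weighted_max_bound {C r γ : ℝ} (hC : 0 ≤ C) (hr : r < 1) (hγ : 0 ≤ γ) :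
    ∃ K : ℝ, 0 ≤ K ∧ ∀ {Ω : Type*} [MeasurableSpace Ω] (m : Measure Ω) [IsProbabilityMeasure m]
      (Z : ℕ → Ω → ℝ) (V : ℝ) (n : ℕ), 1 ≤ n → 0 ≤ V → (∀ i < n, MemLp (Z i) 2 m) →
      (∀ i < n, ∫ ω, Z i ω ^ 2 ∂m ≤ V) →
      (∀ i k : ℕ, 1 ≤ k → i + k < n →
        |∫ ω, Z i ω * Z (i + k) ω ∂m| ≤ C * (k : ℝ) ^ (-r) * V) →
      ∃ G : Ω → ℝ, Integrable G m ∧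
        (∀ ω k, 1 ≤ k → k ≤ n → (k : ℝ) ^ (-γ) * |∑ i ∈ Finset.range k, Z i ω| ≤ G ω) ∧
        ∫ ω, G ω ∂m ≤ K * √V * ((n : ℝ) ^ (1 - γ) * noiseRate γ r n) := by
  obtain ⟨K₁, hK₁, hvarK⟩ := integral_sq_partialSum_sub_le hC hr
  obtain ⟨K₂, hK₂, hgeo⟩ := sum_rpow_le_noiseRate γ r
  set α : ℝ := 2 - r with hα
  set p : ℝ := (2 : ℝ) ^ (α / 2) with hp
  set q : ℝ := (2 : ℝ) ^ ((α - 1) / 2) with hq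
  have hq1 : 1 < q := Real.one_lt_rpow (by norm_num) (by linarith)
  have hp0 : 0 < p := Real.rpow_pos_of_pos (by norm_num) _
  have hq0 : 0 < q - 1 := by linarith
  refine ⟨√K₁ * (p / (q - 1)) * K₂, by positivity, fun {Ω} _ m _ Z V n hn hV hZ hvar hcov => ?_⟩
  let W : ℕ → Ω → ℝ := fun i => if i < n then Z i else 0
  have hW : ∀ i < n, W i = Z i := fun i hi => if_pos hi
  have hW0 : ∀ i, ¬ i < n → W i = 0 := fun i hi => if_neg hi
  have hWL : ∀ i, MemLp (W i) 2 m := fun i => by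
    by_cases hi : i < n
    · rw [hW i hi]; exact hZ i hi
    · rw [hW0 i hi]; exact MemLp.zero
  have hWv := hvarK m W V hV hWL (fun i => by
    by_cases hi : i < n
    · rw [hW i hi]; exact hvar i hi
    · rw [hW0 i hi]; simpa using hV) (fun i k hk => by
    by_cases hi : i + k < n
    · rw [hW _ hi, hW i (by omega)]; exact hcov i k hk hi
    · rw [hW0 _ hi]
      simp only [Pi.zero_apply, mul_zero, integral_zero, abs_zero]
      positivity)
  let S : Ω → ℕ → ℝ := fun ω k => ∑ l ∈ Finset.range k, W l ω
  have hint : ∀ J, Integrable (fun ω => dyadicChain (S ω) J) m := integrable_dyadicChain m hWL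
  have hle := integral_dyadicChain_le m hWL (mul_nonneg hK₁ hV) (by linarith : 1 < 2 - r) hWv
  refine ⟨fun ω => ∑ l ∈ Finset.range (Nat.log 2 n + 1),
    ((2 : ℝ) ^ l) ^ (-γ) * dyadicChain (S ω) (l + 1),
    integrable_finsetSum _ fun l _ => (hint _).const_mul _, fun ω k hk hkn => ?_, ?_⟩
  · have hS : ∑ i ∈ Finset.range k, Z i ω = S ω k := by
      refine Finset.sum_congr rfl fun i hi => ?_
      rw [hW i (by have := Finset.mem_range.1 hi; omega)]
    have hlog : Nat.log 2 k < Nat.log 2 n + 1 := Nat.lt_succ_of_le (Nat.log_mono_right hkn)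
    have h1 : |S ω k| ≤ dyadicChain (S ω) (Nat.log 2 k + 1) :=
      abs_le_dyadicChain _ _ (by simp [S]) k (Nat.lt_pow_succ_log_self (by norm_num) k)
    have h2 : (k : ℝ) ^ (-γ) ≤ ((2 : ℝ) ^ Nat.log 2 k) ^ (-γ) := by
      apply Real.rpow_le_rpow_of_nonpos (by positivity) _ (by linarith)
      exact_mod_cast Nat.pow_log_le_self 2 (by omega)
    rw [hS]
    refine (mul_le_mul h2 h1 (abs_nonneg _) (by positivity)).trans ?_
    exact Finset.single_le_sum
      (f := fun l => ((2 : ℝ) ^ l) ^ (-γ) * dyadicChain (S ω) (l + 1))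
      (fun l _ => mul_nonneg (by positivity) (dyadicChain_nonneg _ _)) (Finset.mem_range.2 hlog)
  · rw [integral_finsetSum _ fun l _ => (hint _).const_mul _]
    have hterm : ∀ l ∈ Finset.range (Nat.log 2 n + 1),
        ∫ ω, ((2 : ℝ) ^ l) ^ (-γ) * dyadicChain (S ω) (l + 1) ∂m ≤
          √(K₁ * V) * (p / (q - 1)) * ((2 : ℝ) ^ (1 - r / 2 - γ)) ^ l := by
      intro l _
      rw [integral_const_mul]
      refine (mul_le_mul_of_nonneg_left (hle (l + 1)) (by positivity)).trans (le_of_eq ?_)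
      have hy : ((2 : ℝ) ^ (1 - r / 2 - γ)) ^ l = ((2 : ℝ) ^ l) ^ (-γ) * p ^ l := by
        rw [hp, hα, ← Real.rpow_natCast, ← Real.rpow_natCast, ← Real.rpow_natCast,
          ← Real.rpow_mul (by positivity), ← Real.rpow_mul (by positivity),
          ← Real.rpow_mul (by positivity), ← Real.rpow_add (by norm_num)]
        congr 1; ring
      rw [hy, pow_succ]
      ring
    refine (Finset.sum_le_sum hterm).trans ?_
    rw [← Finset.mul_sum, Real.sqrt_mul hK₁]
    calc _ ≤ √K₁ * √V * (p / (q - 1)) * (K₂ * ((n : ℝ) ^ (1 - γ) * noiseRate γ r n)) := by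
          gcongr
          exact hgeo n hn
      _ = _ := by ring

theorem weight_div_le {γ : ℝ} (hγ1 : γ < 1) {k n : ℝ} (hk : 0 < k) (hkn : k ≤ n) :
    ((k / n) * (1 - k / n)) ^ (1 - γ) * k⁻¹ ≤ n ^ (γ - 1) * k ^ (-γ) := by
  have hn : 0 < n := hk.trans_le hkn
  have h1 : k / n ≤ 1 := (div_le_one hn).2 hkn
  have h0 : 0 < k / n := by positivity
  have h2 : ((k / n) * (1 - k / n)) ^ (1 - γ) ≤ (k / n) ^ (1 - γ) :=
    Real.rpow_le_rpow (mul_nonneg h0.le (by linarith)) (by nlinarith) (by linarith)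
  refine (mul_le_mul_of_nonneg_right h2 (by positivity)).trans (le_of_eq ?_)
  rw [Real.div_rpow hk.le hn.le, show γ - 1 = -(1 - γ) by ring, Real.rpow_neg hn.le,
    show -γ = (1 - γ) + (-1) by ring, Real.rpow_add hk, Real.rpow_neg_one]
  ring

/-- Maximal inequality for the weighted difference of the two empirical means. -/
theorem exists_weighted_difference_bound {C r γ : ℝ} (hC : 0 ≤ C) (hr : r < 1) (hγ : 0 ≤ γ)
    (hγ1 : γ < 1) :
    ∃ K : ℝ, 0 ≤ K ∧ ∀ {Ω : Type*} [MeasurableSpace Ω] (m : Measure Ω) [IsProbabilityMeasure m]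
      (Z : ℕ → Ω → ℝ) (V : ℝ) (n : ℕ), 1 ≤ n → 0 ≤ V → (∀ i < n, MemLp (Z i) 2 m) →
      (∀ i < n, ∫ ω, Z i ω ^ 2 ∂m ≤ V) →
      (∀ i k : ℕ, 1 ≤ k → i + k < n →
        |∫ ω, Z i ω * Z (i + k) ω ∂m| ≤ C * (k : ℝ) ^ (-r) * V) →
      ∃ G : Ω → ℝ, Integrable G m ∧
        (∀ ω k, 1 ≤ k → k < n →
          |(((k : ℝ) / n) * (1 - (k : ℝ) / n)) ^ (1 - γ) *
            ((k : ℝ)⁻¹ * ∑ i ∈ Finset.range k, Z i ω -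
              ((n : ℝ) - k)⁻¹ * ∑ i ∈ Finset.Ico k n, Z i ω)| ≤ G ω) ∧
        ∫ ω, G ω ∂m ≤ K * √V * noiseRate γ r n := by
  obtain ⟨K, hK, hmax⟩ := exists_weighted_max_bound hC hr hγ
  refine ⟨2 * K, by positivity, fun {Ω} _ m _ Z V n hn hV hZ hvar hcov => ?_⟩
  obtain ⟨G₁, hG₁, hle₁, hint₁⟩ := hmax m Z V n hn hV hZ hvar hcov
  obtain ⟨G₂, hG₂, hle₂, hint₂⟩ := hmax m (fun i => Z (n - 1 - i)) V n hn hV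
    (fun i hi => hZ _ (by omega)) (fun i hi => hvar _ (by omega)) (fun i k hk hik => by
      have := hcov (n - 1 - (i + k)) k hk (by omega)
      rw [show n - 1 - (i + k) + k = n - 1 - i by omega] at this
      simpa only [mul_comm] using this)
  have hn0 : (0 : ℝ) < n := by exact_mod_cast hn
  refine ⟨fun ω => (n : ℝ) ^ (γ - 1) * (G₁ ω + G₂ ω), (hG₁.add hG₂).const_mul _,
    fun ω k hk hkn => ?_, ?_⟩
  · have hk0 : (0 : ℝ) < k := by exact_mod_cast hk
    have hkn' : (k : ℝ) < n := by exact_mod_cast hkn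
    have hcast : ((n - k : ℕ) : ℝ) = (n : ℝ) - k := by
      rw [Nat.cast_sub hkn.le]
    have hw0 : 0 ≤ ((k : ℝ) / n) * (1 - (k : ℝ) / n) := by
      have : (k : ℝ) / n ≤ 1 := (div_le_one hn0).2 hkn'.le
      exact mul_nonneg (by positivity) (by linarith)
    have hrev : ∑ i ∈ Finset.Ico k n, Z i ω = ∑ i ∈ Finset.range (n - k), Z (n - 1 - i) ω := by
      refine Finset.sum_nbij' (fun i => n - 1 - i) (fun i => n - 1 - i) ?_ ?_ ?_ ?_ ?_
      · intro i hi; simp only [Finset.mem_Ico, Finset.mem_range] at *; omega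
      · intro i hi; simp only [Finset.mem_Ico, Finset.mem_range] at *; omega
      · intro i hi; simp only [Finset.mem_Ico] at *; omega
      · intro i hi; simp only [Finset.mem_range] at *; omega
      · intro i hi
        simp only [Finset.mem_Ico] at hi
        rw [show n - 1 - (n - 1 - i) = i by omega]
    have h1 := hle₁ ω k hk hkn.le
    have h2 := hle₂ ω (n - k) (by omega) (by omega)
    rw [← hrev, hcast] at h2
    have hw1 := weight_div_le hγ1 hk0 hkn'.le
    have hw2 := weight_div_le hγ1 (k := (n : ℝ) - k) (n := n) (by linarith) (by linarith)
    rw [show ((n : ℝ) - k) / n = 1 - (k : ℝ) / n by field_simp, sub_sub_cancel,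
      mul_comm (1 - (k : ℝ) / n)] at hw2
    set w := (((k : ℝ) / n) * (1 - (k : ℝ) / n)) ^ (1 - γ)
    have hwn : 0 ≤ w := Real.rpow_nonneg hw0 _
    set s₁ := ∑ i ∈ Finset.range k, Z i ω
    set s₂ := ∑ i ∈ Finset.Ico k n, Z i ω
    have hnγ : 0 ≤ (n : ℝ) ^ (γ - 1) := by positivity
    have hik : 0 ≤ w * (k : ℝ)⁻¹ := by positivity
    have hink : 0 ≤ w * ((n : ℝ) - k)⁻¹ := mul_nonneg hwn (inv_nonneg.2 (by linarith))
    calc |w * ((k : ℝ)⁻¹ * s₁ - ((n : ℝ) - k)⁻¹ * s₂)|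
        = |w * (k : ℝ)⁻¹ * s₁ - w * ((n : ℝ) - k)⁻¹ * s₂| := by congr 1; ring
      _ ≤ |w * (k : ℝ)⁻¹ * s₁| + |w * ((n : ℝ) - k)⁻¹ * s₂| := abs_sub _ _
      _ = w * (k : ℝ)⁻¹ * |s₁| + w * ((n : ℝ) - k)⁻¹ * |s₂| := by
        rw [abs_mul, abs_mul _ s₂, abs_of_nonneg hik, abs_of_nonneg hink]
      _ ≤ (n : ℝ) ^ (γ - 1) * (k : ℝ) ^ (-γ) * |s₁| +
          (n : ℝ) ^ (γ - 1) * ((n : ℝ) - k) ^ (-γ) * |s₂| := by gcongr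
      _ = (n : ℝ) ^ (γ - 1) * ((k : ℝ) ^ (-γ) * |s₁| + ((n : ℝ) - k) ^ (-γ) * |s₂|) := by ring
      _ ≤ _ := mul_le_mul_of_nonneg_left (add_le_add h1 h2) hnγ
  · rw [integral_const_mul, integral_add hG₁ hG₂]
    have hnn : (n : ℝ) ^ (γ - 1) * (n : ℝ) ^ (1 - γ) = 1 := by
      rw [← Real.rpow_add hn0, show γ - 1 + (1 - γ) = 0 by ring, Real.rpow_zero]
    calc _ ≤ (n : ℝ) ^ (γ - 1) * (K * √V * ((n : ℝ) ^ (1 - γ) * noiseRate γ r n) +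
            K * √V * ((n : ℝ) ^ (1 - γ) * noiseRate γ r n)) := by gcongr
      _ = _ := by linear_combination (2 * K * √V * noiseRate γ r n) * hnn

/-- The coefficient of `P - Q` in the mean of the weighted difference of empirical measures at the
relative position `t`, when the change occurs at the relative position `τ`. -/
noncomputable def driftCoeff (γ τ t : ℝ) : ℝ :=
  (t * (1 - t)) ^ (1 - γ) * (if t ≤ τ then (1 - τ) / (1 - t) else τ / t)

theorem driftCoeff_self {γ τ : ℝ} (hτ : τ < 1) : driftCoeff γ τ τ = (τ * (1 - τ)) ^ (1 - γ) := by
  rw [driftCoeff, if_pos le_rfl, div_self (by linarith), mul_one]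

theorem driftCoeff_nonneg {γ τ t : ℝ} (hτ0 : 0 < τ) (hτ1 : τ < 1) (ht0 : 0 < t) (ht1 : t < 1) :
    0 ≤ driftCoeff γ τ t := by
  have h1 : 0 < 1 - t := by linarith
  have h2 : 0 < 1 - τ := by linarith
  unfold driftCoeff
  split_ifs <;> positivity

theorem rpow_mul_div_le {γ δ s t : ℝ} (hγ0 : 0 ≤ γ) (hγ1 : γ < 1) (hs0 : 0 < s) (hs1 : s < 1)
    (ht0 : 0 < t) (hst : t ≤ (1 - δ) * s) (hts : t ≤ s) :
    (t * (1 - t)) ^ (1 - γ) * ((1 - s) / (1 - t)) ≤ (1 - δ) ^ (1 - γ) * (s * (1 - s)) ^ (1 - γ) := by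
  have h1 : 0 < 1 - t := by linarith
  have h2 : 0 < 1 - s := by linarith
  have h3 : 0 < 1 - δ := pos_of_mul_pos_left (ht0.trans_le hst) hs0.le
  have e : ∀ u : ℝ, 0 < u → u ^ (1 - γ) = u * u ^ (-γ) := fun u hu => by
    rw [sub_eq_add_neg, Real.rpow_add hu, Real.rpow_one]
  have h4 : t ^ (1 - γ) ≤ (1 - δ) ^ (1 - γ) * s ^ (1 - γ) := by
    rw [← Real.mul_rpow h3.le hs0.le]
    exact Real.rpow_le_rpow ht0.le hst (by linarith)
  have h5 : (1 - t) ^ (-γ) ≤ (1 - s) ^ (-γ) :=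
    Real.rpow_le_rpow_of_nonpos h2 (by linarith) (by linarith)
  rw [Real.mul_rpow ht0.le h1.le, Real.mul_rpow hs0.le h2.le, e _ h1, e _ h2]
  calc _ = t ^ (1 - γ) * (1 - t) ^ (-γ) * (1 - s) := by field_simp
    _ ≤ ((1 - δ) ^ (1 - γ) * s ^ (1 - γ)) * (1 - s) ^ (-γ) * (1 - s) := by gcongr
    _ = _ := by ring

theorem driftCoeff_le {γ δ τ t : ℝ} (hγ0 : 0 ≤ γ) (hγ1 : γ < 1) (hτ0 : 0 < τ) (hτ1 : τ < 1)
    (ht0 : 0 < t) (ht1 : t < 1) (hδ : 0 ≤ δ) (h : δ ≤ |t - τ|) :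
    driftCoeff γ τ t ≤ (1 - δ) ^ (1 - γ) * driftCoeff γ τ τ := by
  rw [driftCoeff_self hτ1, driftCoeff]
  split_ifs with htτ
  · rw [abs_of_nonpos (by linarith)] at h
    exact rpow_mul_div_le hγ0 hγ1 hτ0 hτ1 ht0 (by nlinarith) htτ
  · rw [abs_of_nonneg (by linarith)] at h
    have := rpow_mul_div_le (δ := δ) hγ0 hγ1 (s := 1 - τ) (t := 1 - t) (by linarith) (by linarith)
      (by linarith) (by nlinarith) (by linarith)
    simpa only [sub_sub_cancel, mul_comm (1 - t), mul_comm (1 - τ)] using this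

/-- The mean of the difference of the two empirical means. -/
theorem mean_difference_eq {n m k : ℕ} (hmn : m ≤ n) (hk : 1 ≤ k) (hkn : k < n) (p q : ℝ) :
    (k : ℝ)⁻¹ * ∑ i ∈ Finset.range k, (if i + 1 ≤ m then p else q) -
      ((n : ℝ) - k)⁻¹ * ∑ i ∈ Finset.Ico k n, (if i + 1 ≤ m then p else q) =
    (if (k : ℝ) / n ≤ (m : ℝ) / n then (1 - (m : ℝ) / n) / (1 - (k : ℝ) / n)
      else ((m : ℝ) / n) / ((k : ℝ) / n)) * (p - q) := by
  have hk0 : (0 : ℝ) < k := by exact_mod_cast hk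
  have hkn' : (k : ℝ) < n := by exact_mod_cast hkn
  have hn0 : (0 : ℝ) < n := hk0.trans hkn'
  have hnk : (n : ℝ) - k ≠ 0 := by linarith
  have hsum : ∀ j : ℕ, ∑ i ∈ Finset.range j, (if i + 1 ≤ m then p else q) =
      j * q + (min j m : ℕ) * (p - q) := by
    intro j
    induction j with
    | zero => simp
    | succ j ih =>
      rw [Finset.sum_range_succ, ih]
      by_cases hj : j + 1 ≤ m
      · rw [if_pos hj, min_eq_left (by omega), min_eq_left hj]; push_cast; ring
      · rw [if_neg hj, min_eq_right (by omega), min_eq_right (by omega)]; push_cast; ring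
  rw [Finset.sum_Ico_eq_sub _ hkn.le, hsum, hsum, min_eq_right hmn]
  by_cases hkm : k ≤ m
  · rw [if_pos (by gcongr), min_eq_left hkm]
    have h1 : 1 - (k : ℝ) / n ≠ 0 := by rw [one_sub_div hn0.ne']; exact div_ne_zero hnk hn0.ne'
    field_simp
    ring
  · rw [if_neg (by rw [not_le]; push Not at hkm; gcongr), min_eq_right (by omega)]
    field_simp
    ring

/-- The weighted difference of the empirical measures before and after time `k`. -/
noncomputable def weightedDiff {E : Type*} [MeasurableSpace E] (γ : ℝ) (x : ℕ → E) (n k : ℕ) :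
    SignedMeasure E :=
  (((k : ℝ) / n) * (1 - (k : ℝ) / n)) ^ ((1 : ℝ) - γ) •
    ((k : ℝ)⁻¹ • ∑ i ∈ Finset.Icc 1 k, (Measure.dirac (x i)).toSignedMeasure
      - ((n : ℝ) - k)⁻¹ • ∑ i ∈ Finset.Icc (k + 1) n, (Measure.dirac (x i)).toSignedMeasure)

theorem sIntegral_weightedDiff {E : Type*} [MeasurableSpace E] (γ : ℝ) (x : ℕ → E) (n k : ℕ)
    {f : E → ℝ} (hf : Measurable f) (hb : ∃ B : ℝ, ∀ x, |f x| ≤ B) :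
    sIntegral (weightedDiff γ x n k) f = (((k : ℝ) / n) * (1 - (k : ℝ) / n)) ^ (1 - γ) *
      ((k : ℝ)⁻¹ * ∑ i ∈ Finset.range k, f (x (i + 1)) -
        ((n : ℝ) - k)⁻¹ * ∑ i ∈ Finset.Ico k n, f (x (i + 1))) := by
  rw [weightedDiff, sIntegral_smul, sIntegral_sub _ _ hf hb, sIntegral_smul, sIntegral_smul,
    sIntegral_sum_dirac _ _ hf hb, sIntegral_sum_dirac _ _ hf hb, Finset.range_eq_Ico,
    Finset.sum_Ico_add' (fun i => f (x i)), Finset.sum_Ico_add' (fun i => f (x i))]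
  rfl

/-- Fluctuation bound for one bounded function of a sample with a change of marginal law. -/
theorem exists_empirical_noise_bound {C r γ : ℝ} (hC : 0 ≤ C) (hr : r < 1) (hγ : 0 ≤ γ)
    (hγ1 : γ < 1) :
    ∃ K : ℝ, 0 ≤ K ∧ ∀ {Ω E : Type*} [MeasurableSpace Ω] [MeasurableSpace E] (ℙ : Measure Ω)
      [IsProbabilityMeasure ℙ] (n m : ℕ) (Y : ℕ → Ω → E) (P Q : Measure E)
      [IsProbabilityMeasure P] [IsProbabilityMeasure Q] (f : E → ℝ) (s : ℝ),
      2 ≤ n → m ≤ n → (∀ i, Measurable (Y i)) →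
      (∀ i, 1 ≤ i → i ≤ n → Measure.map (Y i) ℙ = if i ≤ m then P else Q) →
      Measurable f → (∃ B : ℝ, ∀ x, |f x| ≤ B) → 0 ≤ s →
      ∫ x, f x ^ 2 ∂P + ∫ x, f x ^ 2 ∂Q ≤ s ^ 2 →
      (∀ i k : ℕ, 1 ≤ i → 1 ≤ k → i + k ≤ n →
        |covar ℙ (fun ω => f (Y i ω)) (fun ω => f (Y (i + k) ω))| ≤
          C * (k : ℝ) ^ (-r) * √(variance' ℙ fun ω => f (Y i ω)) *
            √(variance' ℙ fun ω => f (Y (i + k) ω))) →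
      ∃ G : Ω → ℝ, Integrable G ℙ ∧
        (∀ ω k, 1 ≤ k → k < n →
          |sIntegral (weightedDiff γ (fun i => Y i ω) n k -
            driftCoeff γ ((m : ℝ) / n) ((k : ℝ) / n) • (P.toSignedMeasure - Q.toSignedMeasure)) f| ≤
              G ω) ∧
        ∫ ω, G ω ∂ℙ ≤ K * s * noiseRate γ r n := by
  obtain ⟨K, hK, hbound⟩ := exists_weighted_difference_bound hC hr hγ hγ1
  refine ⟨K, hK, fun {Ω E} _ _ ℙ _ n m Y P Q _ _ f s hn hmn hY hlaw hf hb hs hfs hcov => ?_⟩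
  have hmem : ∀ i, MemLp (fun ω => f (Y i ω)) 2 ℙ := fun i => by
    obtain ⟨B, hB⟩ := hb
    exact MemLp.of_bound (hf.comp (hY i)).aestronglyMeasurable B
      (Eventually.of_forall fun ω => hB _)
  have hvar : ∀ i, 1 ≤ i → i ≤ n → variance' ℙ (fun ω => f (Y i ω)) ≤ s ^ 2 := by
    intro i hi hin
    have h1 : variance' ℙ (fun ω => f (Y i ω)) ≤ ∫ ω, f (Y i ω) ^ 2 ∂ℙ := by
      have := ProbabilityTheory.variance_le_expectation_sq (μ := ℙ)
        (X := fun ω => f (Y i ω)) (hmem i).aestronglyMeasurable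
      rw [ProbabilityTheory.variance_eq_integral (hmem i).aemeasurable] at this
      simpa only [variance', covar, ← sq, Pi.pow_apply] using this
    have h2 : ∫ ω, f (Y i ω) ^ 2 ∂ℙ = ∫ x, f x ^ 2 ∂(Measure.map (Y i) ℙ) :=
      (integral_map (hY i).aemeasurable (hf.pow_const 2).aestronglyMeasurable).symm
    have hP : 0 ≤ ∫ x, f x ^ 2 ∂P := integral_nonneg fun x => sq_nonneg _
    have hQ : 0 ≤ ∫ x, f x ^ 2 ∂Q := integral_nonneg fun x => sq_nonneg _
    rw [h2, hlaw i hi hin] at h1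
    split_ifs at h1 <;> linarith
  have hmean : ∀ i, 1 ≤ i → i ≤ n → ∫ ω, f (Y i ω) ∂ℙ =
      if i ≤ m then ∫ x, f x ∂P else ∫ x, f x ∂Q := by
    intro i hi hin
    rw [← integral_map (hY i).aemeasurable hf.aestronglyMeasurable, hlaw i hi hin]
    split_ifs <;> rfl
  obtain ⟨G, hG, hle, hGint⟩ := hbound ℙ
    (fun i ω => f (Y (i + 1) ω) - ∫ ω', f (Y (i + 1) ω') ∂ℙ) (s ^ 2) n (by omega) (sq_nonneg s)
    (fun i _ => (hmem _).sub (memLp_const _))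
    (fun i hi => by
      have := hvar (i + 1) (by omega) (by omega)
      simpa only [variance', covar, ← sq] using this)
    (fun i k hk hik => by
      have h1 := hcov (i + 1) k (by omega) hk (by omega)
      have h2 := hvar (i + 1) (by omega) (by omega)
      have h3 := hvar (i + 1 + k) (by omega) (by omega)
      rw [show i + 1 + k = i + k + 1 by omega] at h1 h3
      refine h1.trans ?_
      have h4 := Real.sqrt_le_sqrt h2
      have h5 := Real.sqrt_le_sqrt h3
      rw [Real.sqrt_sq hs] at h4 h5
      calc _ ≤ C * (k : ℝ) ^ (-r) * s * s := by gcongr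
        _ = _ := by ring)
  rw [Real.sqrt_sq hs] at hGint
  refine ⟨G, hG, fun ω k hk hkn => ?_, hGint⟩
  convert hle ω k hk hkn using 2
  have hd := mean_difference_eq hmn hk hkn (∫ x, f x ∂P) (∫ x, f x ∂Q)
  have hm1 : ∑ i ∈ Finset.range k, ∫ ω', f (Y (i + 1) ω') ∂ℙ =
      ∑ i ∈ Finset.range k, (if i + 1 ≤ m then ∫ x, f x ∂P else ∫ x, f x ∂Q) :=
    Finset.sum_congr rfl fun i hi => by
      have := Finset.mem_range.1 hi
      exact hmean (i + 1) (by omega) (by omega)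
  have hm2 : ∑ i ∈ Finset.Ico k n, ∫ ω', f (Y (i + 1) ω') ∂ℙ =
      ∑ i ∈ Finset.Ico k n, (if i + 1 ≤ m then ∫ x, f x ∂P else ∫ x, f x ∂Q) :=
    Finset.sum_congr rfl fun i hi => by
      have := Finset.mem_Ico.1 hi
      exact hmean (i + 1) (by omega) (by omega)
  rw [sIntegral_sub _ _ hf hb, sIntegral_smul, sIntegral_sub _ _ hf hb,
    sIntegral_toSignedMeasure _ hf hb, sIntegral_toSignedMeasure _ hf hb,
    sIntegral_weightedDiff _ _ _ _ hf hb, driftCoeff, mul_assoc, ← hd, Finset.sum_sub_distrib,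
    Finset.sum_sub_distrib, hm1, hm2]
  ring

/-- Reverse triangle inequality around a nonnegative multiple. -/
theorem abs_seminorm_sub_mul_le {M : Type*} [AddCommGroup M] [Module ℝ M] (N : M → ℝ)
    (hN_smul : ∀ (a : ℝ) (ν : M), N (a • ν) = |a| * N ν)
    (hN_add : ∀ ν₁ ν₂ : M, N (ν₁ + ν₂) ≤ N ν₁ + N ν₂) {a : ℝ} (ha : 0 ≤ a) (μ ν : M) :
    |N μ - a * N ν| ≤ N (μ - a • ν) := by
  have h1 : N (a • ν) = a * N ν := by rw [hN_smul, abs_of_nonneg ha]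
  have h2 := hN_add (μ - a • ν) (a • ν)
  have h3 := hN_add ((-1 : ℝ) • (μ - a • ν)) μ
  rw [hN_smul, abs_neg, abs_one, one_mul, show (-1 : ℝ) • (μ - a • ν) + μ = a • ν by module] at h3
  rw [sub_add_cancel] at h2
  rw [abs_le]
  constructor <;> linarith

/-- Uniform fluctuation bound for a seminorm dominated by a weighted family of integrals. -/
theorem exists_seminorm_noise_bound {Ω : Type*} [MeasurableSpace Ω] (ℙ : Measure Ω)
    [IsProbabilityMeasure ℙ] {E : Type*} [MeasurableSpace E] (N : SignedMeasure E → ℝ)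
    (hN_smul : ∀ (a : ℝ) (ν : SignedMeasure E), N (a • ν) = |a| * N ν)
    (hN_add : ∀ ν₁ ν₂ : SignedMeasure E, N (ν₁ + ν₂) ≤ N ν₁ + N ν₂)
    (F : Set (E → ℝ)) (hFcount : F.Countable) (hFmeas : ∀ f ∈ F, Measurable f)
    (d s : (E → ℝ) → ℝ) (hd : ∀ f ∈ F, 0 < d f) (hs : ∀ f ∈ F, 0 ≤ s f)
    (hsum : Summable fun f : F => d f * s f)
    (hNle : ∀ ν : SignedMeasure E, N ν ≤ ∑' f : F, d f * |sIntegral ν f|)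
    {C r γ : ℝ} (hC : 0 ≤ C) (hr : r < 1) (hγ : 0 ≤ γ) (hγ1 : γ < 1) :
    ∃ K : ℝ, 0 ≤ K ∧ ∀ (n m : ℕ) (Y : ℕ → Ω → E) (P Q : Measure E)
      [IsProbabilityMeasure P] [IsProbabilityMeasure Q],
      2 ≤ n → 0 < m → m < n → (∀ i, Measurable (Y i)) →
      (∀ i, 1 ≤ i → i ≤ n → Measure.map (Y i) ℙ = if i ≤ m then P else Q) →
      (∀ f ∈ F, (∃ B : ℝ, ∀ x, |f x| ≤ B) →
        ∫ x, f x ^ 2 ∂P + ∫ x, f x ^ 2 ∂Q ≤ s f ^ 2) →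
      (∀ f ∈ F, ∀ i k : ℕ, 1 ≤ i → 1 ≤ k → i + k ≤ n →
        |covar ℙ (fun ω => f (Y i ω)) (fun ω => f (Y (i + k) ω))| ≤
          C * (k : ℝ) ^ (-r) * √(variance' ℙ fun ω => f (Y i ω)) *
            √(variance' ℙ fun ω => f (Y (i + k) ω))) →
      ∃ H : Ω → ENNReal, AEMeasurable H ℙ ∧
        ∫⁻ ω, H ω ∂ℙ ≤ ENNReal.ofReal (K * noiseRate γ r n) ∧
        ∀ ω, H ω ≠ ⊤ → ∀ k, 1 ≤ k → k < n →
          |N (weightedDiff γ (fun i => Y i ω) n k) - driftCoeff γ ((m : ℝ) / n) ((k : ℝ) / n) *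
            N (P.toSignedMeasure - Q.toSignedMeasure)| ≤ (H ω).toReal := by
  obtain ⟨K, hK, hbound⟩ := exists_empirical_noise_bound hC hr hγ hγ1
  let Fb : Set (E → ℝ) := {f | f ∈ F ∧ ∃ B : ℝ, ∀ x, |f x| ≤ B}
  have hFb : Countable Fb := (hFcount.mono fun f hf => hf.1).to_subtype
  have hds : ∀ f : Fb, 0 ≤ d f * s f := fun f => mul_nonneg (hd _ f.2.1).le (hs _ f.2.1)
  have hsumb : Summable fun f : Fb => d f * s f :=
    hsum.comp_injective (i := fun f : Fb => (⟨f, f.2.1⟩ : F))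
      fun f g h => Subtype.ext (congrArg (fun x : F => (x : E → ℝ)) h)
  refine ⟨K * ∑' f : Fb, d f * s f, mul_nonneg hK (tsum_nonneg hds),
    fun n m Y P Q _ _ hn hm0 hmn hY hlaw hfs hcov => ?_⟩
  choose G hG hle hGint using fun f : Fb => hbound ℙ n m Y P Q f (s f) hn hmn.le hY hlaw
    (hFmeas _ f.2.1) f.2.2 (hs _ f.2.1) (hfs _ f.2.1 f.2.2) (hcov _ f.2.1)
  have hG0 : ∀ f ω, 0 ≤ G f ω := fun f ω =>
    (abs_nonneg _).trans (hle f ω 1 le_rfl (by omega))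
  have hdG0 : ∀ (f : Fb) (ω : Ω), 0 ≤ d f * G f ω := fun f ω => mul_nonneg (hd _ f.2.1).le (hG0 f ω)
  have hmeas : ∀ f : Fb, AEMeasurable (fun ω => ENNReal.ofReal (d f * G f ω)) ℙ := fun f =>
    ((hG f).aemeasurable.const_mul _).ennreal_ofReal
  refine ⟨fun ω => ∑' f : Fb, ENNReal.ofReal (d f * G f ω), AEMeasurable.tsum hmeas, ?_,
    fun ω hω k hk hkn => ?_⟩
  · rw [lintegral_tsum hmeas, mul_assoc, mul_comm (tsum _), ← mul_assoc, ← tsum_mul_left,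
      ENNReal.ofReal_tsum_of_nonneg
        (fun f => mul_nonneg (mul_nonneg hK (noiseRate_nonneg _ _ _)) (hds f))
        (hsumb.mul_left _)]
    refine ENNReal.tsum_le_tsum fun f => ?_
    rw [← ofReal_integral_eq_lintegral_ofReal ((hG f).const_mul _)
      (Eventually.of_forall (hdG0 f)), integral_const_mul]
    refine ENNReal.ofReal_le_ofReal ?_
    calc _ ≤ d f * (K * s f * noiseRate γ r n) :=
          mul_le_mul_of_nonneg_left (hGint f) (hd _ f.2.1).le
      _ = _ := by ring
  · have hsG : Summable fun f : Fb => d f * G f ω := by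
      have := ENNReal.summable_toReal hω
      exact this.congr fun f => ENNReal.toReal_ofReal (hdG0 f ω)
    have heq : (∑' f : Fb, ENNReal.ofReal (d f * G f ω)).toReal = ∑' f : Fb, d f * G f ω := by
      rw [← ENNReal.ofReal_tsum_of_nonneg (fun f => hdG0 f ω) hsG,
        ENNReal.toReal_ofReal (tsum_nonneg fun f => hdG0 f ω)]
    rw [heq]
    have hn0 : (0 : ℝ) < n := by exact_mod_cast (by omega : 0 < n)
    have hgk : 0 ≤ driftCoeff γ ((m : ℝ) / n) ((k : ℝ) / n) := by
      apply driftCoeff_nonneg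
      · exact div_pos (by exact_mod_cast hm0) hn0
      · rw [div_lt_one hn0]; exact_mod_cast hmn
      · exact div_pos (by exact_mod_cast hk) hn0
      · rw [div_lt_one hn0]; exact_mod_cast hkn
    have hterm : ∀ f : Fb, d f * |sIntegral (weightedDiff γ (fun i => Y i ω) n k -
        driftCoeff γ ((m : ℝ) / n) ((k : ℝ) / n) • (P.toSignedMeasure - Q.toSignedMeasure)) f| ≤
        d f * G f ω := fun f =>
      mul_le_mul_of_nonneg_left (hle f ω k hk hkn) (hd _ f.2.1).le
    have hsI := Summable.of_nonneg_of_le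
      (fun f : Fb => mul_nonneg (hd _ f.2.1).le (abs_nonneg _)) hterm hsG
    refine (abs_seminorm_sub_mul_le N hN_smul hN_add hgk _ _).trans ?_
    exact (seminorm_le_tsum_bounded N hN_smul hN_add F hFcount hFmeas d hd hNle _ hsI).trans
      (hsI.tsum_le_tsum hterm hsG)

/-- The smallest maximizer of a finite sequence is a maximizer. -/
theorem sInf_argmax_mem (V : ℕ → ℝ) {n : ℕ} (hn : 2 ≤ n) :
    sInf {k : ℕ | k ∈ Finset.Ico 1 n ∧ ∀ j ∈ Finset.Ico 1 n, V j ≤ V k} ∈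
      {k : ℕ | k ∈ Finset.Ico 1 n ∧ ∀ j ∈ Finset.Ico 1 n, V j ≤ V k} :=
  Nat.sInf_mem ((Finset.Ico 1 n).exists_max_image V ⟨1, Finset.mem_Ico.2 ⟨le_rfl, hn⟩⟩)

/-- If the noise is small compared to the drift, a maximizer is close to the change point. -/
theorem abs_argmax_sub_lt {γ δ Δ h : ℝ} {V : ℕ → ℝ} {n m k : ℕ} (hγ0 : 0 ≤ γ) (hγ1 : γ < 1)
    (hδ : 0 ≤ δ) (hΔ : 0 ≤ Δ) (hm0 : 0 < m) (hmn : m < n) (hk : k ∈ Finset.Ico 1 n)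
    (hmax : ∀ j ∈ Finset.Ico 1 n, V j ≤ V k)
    (hV : ∀ j, 1 ≤ j → j < n →
      |V j - driftCoeff γ ((m : ℝ) / n) ((j : ℝ) / n) * Δ| ≤ h)
    (hsmall : 2 * h < driftCoeff γ ((m : ℝ) / n) ((m : ℝ) / n) * (1 - (1 - δ) ^ (1 - γ)) * Δ) :
    |(k : ℝ) / n - (m : ℝ) / n| < δ := by
  by_contra! hcon
  obtain ⟨hk1, hkn⟩ := Finset.mem_Ico.1 hk
  have hn0 : (0 : ℝ) < n := by exact_mod_cast (by omega : 0 < n)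
  have h1 := driftCoeff_le hγ0 hγ1 (τ := (m : ℝ) / n) (t := (k : ℝ) / n)
    (div_pos (by exact_mod_cast hm0) hn0) (by rw [div_lt_one hn0]; exact_mod_cast hmn)
    (div_pos (by exact_mod_cast hk1) hn0) (by rw [div_lt_one hn0]; exact_mod_cast hkn) hδ hcon
  have h2 := mul_le_mul_of_nonneg_right h1 hΔ
  have h3 := (abs_le.1 (hV m hm0 hmn)).1
  have h4 := (abs_le.1 (hV k hk1 hkn)).2
  have h5 := hmax m (Finset.mem_Ico.2 ⟨hm0, hmn⟩)
  linarith

/-- A property whose probability of failure tends to zero holds eventually when it is not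
random. -/
theorem eventually_not_of_tendsto_measure_const {Ω : Type*} [MeasurableSpace Ω] (ℙ : Measure Ω)
    [IsProbabilityMeasure ℙ] {p : ℕ → Prop}
    (h : Tendsto (fun n => ℙ {_ω : Ω | p n}) atTop (nhds 0)) : ∀ᶠ n in atTop, ¬ p n := by
  filter_upwards [h.eventually_lt_const zero_lt_one] with n hn hp
  simp [hp] at hn

/-- **Proposition 1** (consistency of the change-point estimator under the
hypotheses of Theorem 1). -/
theorem changePoint_consistency_countable_family
    {Ω : Type*} [MeasurableSpace Ω] (ℙ : Measure Ω) [IsProbabilityMeasure ℙ]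
    {E : Type*} [MeasurableSpace E]
    -- the change point and the exponent of the weight
    (θ γ : ℝ) (hθ0 : 0 < θ) (hθ1 : θ < 1) (hγ0 : 0 ≤ γ) (hγ1 : γ < 1)
    -- the observations and their marginal laws
    (X : ℕ → ℕ → Ω → E) (hXmeas : ∀ n i, Measurable (X n i))
    (P Q : ℕ → Measure E) [∀ n, IsProbabilityMeasure (P n)] [∀ n, IsProbabilityMeasure (Q n)]
    (hlaw : ∀ n i, 1 ≤ i → i ≤ n →
      Measure.map (X n i) ℙ = if (i : ℝ) ≤ (n : ℝ) * θ then P n else Q n)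
    -- the seminorm on the space of finite signed measures
    (N : SignedMeasure E → ℝ)
    (hN_smul : ∀ (a : ℝ) (ν : SignedMeasure E), N (a • ν) = |a| * N ν)
    (hN_add : ∀ ν₁ ν₂ : SignedMeasure E, N (ν₁ + ν₂) ≤ N ν₁ + N ν₂)
    -- the weighted difference of empirical measures `D_k` (for `1 ≤ k < n`)
    (D : ℕ → ℕ → Ω → SignedMeasure E)
    (hD : ∀ n k ω, 1 ≤ k → k < n →
      D n k ω = (((k : ℝ) / n) * (1 - (k : ℝ) / n)) ^ ((1 : ℝ) - γ) •
        ((k : ℝ)⁻¹ • ∑ i ∈ Finset.Icc 1 k, (Measure.dirac (X n i ω)).toSignedMeasure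
          - ((n : ℝ) - k)⁻¹ •
              ∑ i ∈ Finset.Icc (k + 1) n, (Measure.dirac (X n i ω)).toSignedMeasure))
    -- the estimator: `1/n` times the smallest maximizer of `N(D_k)` over `1 ≤ k < n`
    (θhat : ℕ → Ω → ℝ)
    (hθhat : ∀ n ω, θhat n ω = (n : ℝ)⁻¹ *
      ((sInf {k : ℕ | k ∈ Finset.Ico 1 n ∧
        ∀ j ∈ Finset.Ico 1 n, N (D n j ω) ≤ N (D n k ω)} : ℕ) : ℝ))
    -- the countable family `F`, the weights `d(f)` and the norms `‖f‖`
    (F : Set (E → ℝ)) (hFcount : F.Countable) (hFmeas : ∀ f ∈ F, Measurable f)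
    (normF : (E → ℝ) → ℝ)
    (hnormF : ∀ f : E → ℝ, normF f =
      ⨆ n : ℕ, Real.sqrt ((∫ x, f x ^ 2 ∂(P n)) + ∫ x, f x ^ 2 ∂(Q n)))
    (d : (E → ℝ) → ℝ) (hd : ∀ f ∈ F, 0 < d f)
    (hdsum : Summable fun f : F => d f * normF f)
    -- condition (2.9): the seminorm is dominated by the weighted moments
    (hNle : ∀ ν : SignedMeasure E, N ν ≤ ∑' f : F, d f * |sIntegral ν f|)
    -- Assumption 1: algebraic decay of correlations, uniformly over `F`
    (C ρ : ℝ) (hC : 0 < C) (hρ : 0 < ρ)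
    (hA1 : ∀ f ∈ F, ∀ n i m : ℕ, 1 ≤ i → 1 ≤ m → i + m ≤ n →
      |covar ℙ (fun ω => f (X n i ω)) (fun ω => f (X n (i + m) ω))| ≤
        C * (m : ℝ) ^ (-ρ) *
          Real.sqrt (variance' ℙ fun ω => f (X n i ω)) *
          Real.sqrt (variance' ℙ fun ω => f (X n (i + m) ω)))
    -- `ρ̄ = min (1 - ε) ρ` for an arbitrarily small fixed `ε > 0`
    (ε : ℝ) (hε : 0 < ε)
    -- condition (2.10) on the sequence `b_n`
    (b : ℕ → ℝ) (hb : ∀ n, 0 < b n)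
    (h210 : Tendsto (fun n =>
      ℙ {ω | N ((P n).toSignedMeasure - (Q n).toSignedMeasure) ≤ b n}) atTop (nhds 0))
    -- condition (2.11)
    (h211 : Tendsto (fun n : ℕ => (b n)⁻¹ *
      ((n : ℝ) ^ (-(min (1 - ε) ρ) / 2) *
          (1 + Real.log n * (if γ - 1 + min (1 - ε) ρ / 2 = 0 then (1 : ℝ) else 0)) +
        (n : ℝ) ^ (γ - 1))) atTop (nhds 0)) :
    -- conclusion: consistency of the estimator
    ∀ η : ℝ, 0 < η →
      Tendsto (fun n => ℙ {ω | η < |θhat n ω - θ|}) atTop (nhds 0) := by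
  intro η hη
  set r := min (1 - ε) ρ with hr
  have hr1 : r < 1 := (min_le_left _ _).trans_lt (by linarith)
  have hcov : ∀ n, ∀ f ∈ F, ∀ i k : ℕ, 1 ≤ i → 1 ≤ k → i + k ≤ n →
      |covar ℙ (fun ω => f (X n i ω)) (fun ω => f (X n (i + k) ω))| ≤
        C * (k : ℝ) ^ (-r) * √(variance' ℙ fun ω => f (X n i ω)) *
          √(variance' ℙ fun ω => f (X n (i + k) ω)) := by
    intro n f hf i k hi hk hik
    refine (hA1 f hf n i k hi hk hik).trans ?_
    have hk1 : (1 : ℝ) ≤ k := by exact_mod_cast hk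
    have hrρ : -ρ ≤ -r := neg_le_neg (min_le_right _ _)
    gcongr
  have hnorm0 : ∀ f ∈ F, 0 ≤ normF f := fun f _ => by
    rw [hnormF]
    exact Real.iSup_nonneg fun n => Real.sqrt_nonneg _
  have hnorm : ∀ n, ∀ f ∈ F, (∃ B : ℝ, ∀ x, |f x| ≤ B) →
      ∫ x, f x ^ 2 ∂(P n) + ∫ x, f x ^ 2 ∂(Q n) ≤ normF f ^ 2 := by
    rintro n f hf ⟨B, hB⟩
    have hle : ∀ μ : Measure E, [IsProbabilityMeasure μ] → ∫ x, f x ^ 2 ∂μ ≤ B ^ 2 := by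
      intro μ _
      refine (integral_mono_of_nonneg (Eventually.of_forall fun x => sq_nonneg _)
        (integrable_const (B ^ 2)) (Eventually.of_forall fun x => ?_)).trans_eq (by simp)
      exact sq_le_sq.2 ((hB x).trans (le_abs_self B))
    have hbdd : BddAbove (Set.range fun n : ℕ =>
        √((∫ x, f x ^ 2 ∂(P n)) + ∫ x, f x ^ 2 ∂(Q n))) :=
      ⟨√(B ^ 2 + B ^ 2), Set.forall_mem_range.2 fun j =>
        Real.sqrt_le_sqrt (add_le_add (hle (P j)) (hle (Q j)))⟩
    have h := le_ciSup hbdd n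
    rw [← hnormF] at h
    exact (Real.sqrt_le_iff.1 h).2
  obtain ⟨K, hK, hnoise⟩ := exists_seminorm_noise_bound ℙ N hN_smul hN_add F hFcount hFmeas d normF
    hd hnorm0 hdsum hNle hC.le hr1 hγ0 hγ1
  let m : ℕ → ℕ := fun n => ⌊(n : ℝ) * θ⌋₊
  have hlaw' : ∀ n i, 1 ≤ i → i ≤ n → Measure.map (X n i) ℙ = if i ≤ m n then P n else Q n := by
    intro n i hi hin
    simp only [hlaw n i hi hin, m, Nat.le_floor_iff (show 0 ≤ (n : ℝ) * θ by positivity)]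
  have hmlim : Tendsto (fun n : ℕ => (m n : ℝ) / n) atTop (nhds θ) := by
    have := (tendsto_nat_floor_mul_div_atTop hθ0.le).comp (tendsto_natCast_atTop_atTop (R := ℝ))
    simpa only [m, mul_comm, Function.comp_def] using this
  set δ : ℝ := min (η / 2) (1 / 2) with hδ
  have hδ0 : 0 < δ := by positivity
  have hδ1 : δ ≤ 1 / 2 := min_le_right _ _
  have hu : (1 - δ) ^ (1 - γ) < 1 :=
    Real.rpow_lt_one (by linarith) (by linarith) (by linarith)
  have hw : 0 < (θ * (1 - θ)) ^ (1 - γ) :=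
    Real.rpow_pos_of_pos (mul_pos hθ0 (by linarith)) _
  set c : ℝ := (θ * (1 - θ)) ^ (1 - γ) / 2 * (1 - (1 - δ) ^ (1 - γ)) with hc
  have hc0 : 0 < c := mul_pos (by positivity) (by linarith)
  have hwlim : Tendsto (fun n : ℕ => ((m n : ℝ) / n * (1 - (m n : ℝ) / n)) ^ (1 - γ)) atTop
      (nhds ((θ * (1 - θ)) ^ (1 - γ))) :=
    (hmlim.mul (hmlim.const_sub 1)).rpow_const (Or.inr (by linarith))
  have hdrift := eventually_not_of_tendsto_measure_const ℙ h210
  have hlim : Tendsto (fun n : ℕ =>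
      ENNReal.ofReal (2 * K / c * ((b n)⁻¹ * noiseRate γ r n))) atTop (nhds 0) := by
    have := ENNReal.tendsto_ofReal (Tendsto.const_mul (2 * K / c) h211)
    rwa [mul_zero, ENNReal.ofReal_zero] at this
  refine tendsto_of_tendsto_of_tendsto_of_le_of_le' tendsto_const_nhds hlim
    (Eventually.of_forall fun _ => zero_le) ?_
  filter_upwards [eventually_ge_atTop 2, hdrift, hmlim.eventually_const_lt hθ0,
    hmlim.eventually_lt_const hθ1, Metric.tendsto_nhds.1 hmlim (η / 2) (by positivity),
    hwlim.eventually_const_lt (half_lt_self hw)] with n hn hΔ hm0 hm1 hmθ hwn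
  have hn0 : (0 : ℝ) < n := by exact_mod_cast (by omega : 0 < n)
  have hm0' : 0 < m n := by exact_mod_cast (div_pos_iff_of_pos_right hn0).1 hm0
  have hmn : m n < n := by exact_mod_cast (div_lt_one hn0).1 hm1
  rw [not_le] at hΔ
  obtain ⟨H, hH, hHint, hHle⟩ := hnoise n (m n) (X n) (P n) (Q n) hn hm0' hmn (hXmeas n)
    (hlaw' n) (hnorm n) (hcov n)
  have hcb : 0 < c * b n / 2 := by have := hb n; positivity
  have hsub : {ω | η < |θhat n ω - θ|} ⊆ {ω | ENNReal.ofReal (c * b n / 2) ≤ H ω} := by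
    intro ω hω
    by_contra hHω
    rw [Set.mem_ofPred_eq, not_le] at hHω
    have hHtop : H ω ≠ ⊤ := hHω.ne_top
    have hHreal : (H ω).toReal < c * b n / 2 := (ENNReal.lt_ofReal_iff_toReal_lt hHtop).1 hHω
    obtain ⟨hk, hmax⟩ := sInf_argmax_mem (fun k => N (D n k ω)) hn
    have hclose := abs_argmax_sub_lt hγ0 hγ1 hδ0.le ((hb n).trans hΔ).le hm0' hmn hk hmax
      (fun j hj hjn => by
        rw [hD n j ω hj hjn]
        exact hHle ω hHtop j hj hjn) (by
        rw [driftCoeff_self hm1]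
        have h1 : c < ((m n : ℝ) / n * (1 - (m n : ℝ) / n)) ^ (1 - γ) *
            (1 - (1 - δ) ^ (1 - γ)) := mul_lt_mul_of_pos_right hwn (by linarith)
        have h2 := mul_lt_mul h1 hΔ.le (hb n) (hc0.trans h1).le
        linarith)
    have hω' : η < |θhat n ω - θ| := hω
    rw [hθhat, inv_mul_eq_div] at hω'
    have h3 := abs_sub_le (((sInf {k : ℕ | k ∈ Finset.Ico 1 n ∧
      ∀ j ∈ Finset.Ico 1 n, N (D n j ω) ≤ N (D n k ω)} : ℕ) : ℝ) / n) ((m n : ℝ) / n) θ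
    rw [Real.dist_eq] at hmθ
    have h4 : δ ≤ η / 2 := min_le_left _ _
    linarith
  calc ℙ {ω | η < |θhat n ω - θ|} ≤ ℙ {ω | ENNReal.ofReal (c * b n / 2) ≤ H ω} :=
        measure_mono hsub
    _ ≤ (∫⁻ ω, H ω ∂ℙ) / ENNReal.ofReal (c * b n / 2) :=
        meas_ge_le_lintegral_div hH (ENNReal.ofReal_pos.2 hcb).ne' ENNReal.ofReal_ne_top
    _ ≤ ENNReal.ofReal (K * noiseRate γ r n) / ENNReal.ofReal (c * b n / 2) :=
        ENNReal.div_le_div_right hHint _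
    _ = ENNReal.ofReal (2 * K / c * ((b n)⁻¹ * noiseRate γ r n)) := by
        rw [← ENNReal.ofReal_div_of_pos hcb]
        congr 1
        have := (hb n).ne'
        field_simp
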